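/- Let A be a gentle algebra of rank 2. Then every pre-tilting A-module is partial-tilting, i.e. for every pre-tilting module M there exists a module N such that M ⊕ N is a tilting module. -/

import Mathlib

open CategoryTheory

universe u

/-- The combinatorial data of a gentle presentation: a finite quiver together with a
set of relations given by composable paths of length two, satisfying the gentle
conditions. -/
structure GentleQuiverData : Type (u + 1) where
  /-- vertices -/
  V : Type u
  /-- arrows -/
  E : Type u
  fintV : Fintype V
  fintE : Fintype E
  /-- source -/
  src : E → V
  /-- target -/
  tgt : E → V
  /-- `rel a b` means that the length-two path `ab` is one of the generating relations -/
  rel : E → E → Prop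
  rel_comp : ∀ a b, rel a b → tgt a = src b
  src_le_two : ∀ v : V, Set.ncard {a : E | src a = v} ≤ 2
  tgt_le_two : ∀ v : V, Set.ncard {a : E | tgt a = v} ≤ 2
  rel_right_unique : ∀ a b c, rel a b → rel a c → b = c
  rel_left_unique : ∀ a b c, rel b a → rel c a → b = c
  nonrel_right_unique : ∀ a b c, tgt a = src b → ¬ rel a b → tgt a = src c → ¬ rel a c → b = c
  nonrel_left_unique : ∀ a b c, tgt b = src a → ¬ rel b a → tgt c = src a → ¬ rel c a → b = c

attribute [instance] GentleQuiverData.fintV GentleQuiverData.fintE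

/-- The quiver is connected. -/
def GentleQuiverData.Connected (Q : GentleQuiverData.{u}) : Prop :=
  ∀ v w : Q.V, Relation.ReflTransGen
    (fun x y => ∃ a : Q.E, (Q.src a = x ∧ Q.tgt a = y) ∨ (Q.src a = y ∧ Q.tgt a = x)) v w

variable (k : Type u) [Field k]

/-- The relations presenting the gentle algebra `kQ/I` as a quotient of the free algebra
on vertices and arrows: the vertices are orthogonal idempotents summing to `1`, arrows are
compatible with sources and targets, and the chosen length-two paths vanish. -/
inductive GentleRel (Q : GentleQuiverData.{u}) :
    FreeAlgebra k (Q.V ⊕ Q.E) → FreeAlgebra k (Q.V ⊕ Q.E) → Prop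
  | idem (v : Q.V) :
      GentleRel Q (FreeAlgebra.ι k (Sum.inl v) * FreeAlgebra.ι k (Sum.inl v))
        (FreeAlgebra.ι k (Sum.inl v))
  | orth (v w : Q.V) : v ≠ w →
      GentleRel Q (FreeAlgebra.ι k (Sum.inl v) * FreeAlgebra.ι k (Sum.inl w)) 0
  | sum_idem :
      GentleRel Q (∑ v : Q.V, FreeAlgebra.ι k (Sum.inl v)) 1
  | src_mul (a : Q.E) :
      GentleRel Q (FreeAlgebra.ι k (Sum.inl (Q.src a)) * FreeAlgebra.ι k (Sum.inr a))
        (FreeAlgebra.ι k (Sum.inr a))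
  | mul_tgt (a : Q.E) :
      GentleRel Q (FreeAlgebra.ι k (Sum.inr a) * FreeAlgebra.ι k (Sum.inl (Q.tgt a)))
        (FreeAlgebra.ι k (Sum.inr a))
  | relation (a b : Q.E) : Q.rel a b →
      GentleRel Q (FreeAlgebra.ι k (Sum.inr a) * FreeAlgebra.ι k (Sum.inr b)) 0

/-- The gentle algebra `kQ/I` associated to gentle quiver data. -/
abbrev GentleAlg (Q : GentleQuiverData.{u}) : Type u := RingQuot (GentleRel k Q)

section Modules

variable {B : Type u} [Ring B]

/-- `X` belongs to `add T`: it is a direct summand of a finite direct sum of copies of `T`. -/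
def MemAdd (T X : ModuleCat.{u} B) : Prop :=
  ∃ (n : ℕ) (f : X →ₗ[B] (Fin n → T)) (g : (Fin n → T) →ₗ[B] X), g.comp f = LinearMap.id

/-- An indecomposable module: nonzero, and any direct sum decomposition is trivial. -/
def IsIndec (X : ModuleCat.{u} B) : Prop :=
  Nontrivial X ∧ ∀ Y Z : ModuleCat.{u} B,
    Nonempty (X ≃ₗ[B] Y × Z) → Subsingleton Y ∨ Subsingleton Z

/-- `M` decomposes as the direct sum of the family `N` of pairwise non-isomorphic
indecomposable modules; in particular `M` is multiplicity-free. -/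
def IsIndecDecomp (M : ModuleCat.{u} B) {m : ℕ} (N : Fin m → ModuleCat.{u} B) : Prop :=
  (∀ i, IsIndec (N i)) ∧
  (∀ i j, i ≠ j → IsEmpty (N i ≃ₗ[B] N j)) ∧
  Nonempty (M ≃ₗ[B] ((i : Fin m) → N i))

/-- `M` is multiplicity-free with exactly `m` pairwise non-isomorphic indecomposable
direct summands. -/
def HasRank (M : ModuleCat.{u} B) (m : ℕ) : Prop :=
  ∃ N : Fin m → ModuleCat.{u} B, IsIndecDecomp M N

/-- Projective dimension at most `d`held via an explicit projective resolution. -/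
def ProjDimLE : ModuleCat.{u} B → ℕ → Prop
  | X, 0 => Module.Projective B X
  | X, (d + 1) => ∃ P : ModuleCat.{u} B, Module.Projective B P ∧
      ∃ f : P →ₗ[B] X, Function.Surjective f ∧ ProjDimLE (ModuleCat.of B (LinearMap.ker f)) d

/-- (T1): finite projective dimension. -/
def HasFiniteProjDim (X : ModuleCat.{u} B) : Prop := ∃ d, ProjDimLE X d

/-- There is an exact sequence `0 → X → T₀ → ⋯ → T_d → 0` with all `Tᵢ` in `add T`. -/
def CoresolvedBy (T : ModuleCat.{u} B) : ModuleCat.{u} B → ℕ → Prop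
  | X, 0 => MemAdd T X
  | X, (d + 1) => ∃ T₀ : ModuleCat.{u} B, MemAdd T T₀ ∧
      ∃ f : X →ₗ[B] T₀, Function.Injective f ∧
        CoresolvedBy T (ModuleCat.of B (T₀ ⧸ LinearMap.range f)) d

/-- The Ext-group `Ext^n_B(X, Y)`. -/
noncomputable def ExtGroup (X Y : ModuleCat.{u} B) (n : ℕ) : Type (u + 1) :=
  letI : HasDerivedCategory.{u + 1} (ModuleCat.{u} B) := HasDerivedCategory.standard _
  letI : HasExt.{u + 1} (ModuleCat.{u} B) := hasExt_of_hasDerivedCategory _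
  Abelian.Ext X Y n

/-- (T2): `Ext^i(T, T) = 0` for all `i > 0`. -/
def SelfOrthogonal (T : ModuleCat.{u} B) : Prop :=
  ∀ i : ℕ, 0 < i → Subsingleton (ExtGroup T T i)

/-- Pre-tilting: (T1) and (T2). -/
def IsPreTilting (T : ModuleCat.{u} B) : Prop :=
  HasFiniteProjDim T ∧ SelfOrthogonal T

/-- Tilting: (T1), (T2) and (T3) (an `add T`-coresolution of the regular module). -/
def IsTilting (T : ModuleCat.{u} B) : Prop :=
  HasFiniteProjDim T ∧ SelfOrthogonal T ∧ ∃ d, CoresolvedBy T (ModuleCat.of B B) d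

/-- The direct sum `M ⊕ N`. -/
def dSum (M N : ModuleCat.{u} B) : ModuleCat.{u} B := ModuleCat.of B (M × N)

/-- `N` is an (indecomposable) complement to `M`: a finite-dimensional indecomposable module
not in `add M` such that `M ⊕ N` is a tilting module. -/
def IsComplement (M N : ModuleCat.{u} B) : Prop :=
  Module.Finite B N ∧ IsIndec N ∧ ¬ MemAdd M N ∧ IsTilting (dSum M N)

end Modules

section ExtVanish

lemma hasExt_moduleCat (B : Type u) [Ring B] : HasExt.{u + 1} (ModuleCat.{u} B) :=
  letI : HasDerivedCategory.{u + 1} (ModuleCat.{u} B) := HasDerivedCategory.standard _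
  hasExt_of_hasDerivedCategory _

attribute [local instance] hasExt_moduleCat

variable {B : Type u} [Ring B]

/-- `Ext^n_B(X, Y) = 0`, for unbundled modules. -/
def EV (B : Type u) [Ring B] (n : ℕ) (X Y : Type u) [AddCommGroup X] [Module B X]
    [AddCommGroup Y] [Module B Y] : Prop :=
  Subsingleton (ExtGroup (ModuleCat.of B X) (ModuleCat.of B Y) n)

variable {X Y X₁ X₂ X₃ W : Type u} [AddCommGroup X] [Module B X] [AddCommGroup Y] [Module B Y]
  [AddCommGroup X₁] [Module B X₁] [AddCommGroup X₂] [Module B X₂]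
  [AddCommGroup X₃] [Module B X₃] [AddCommGroup W] [Module B W]

lemma EV.iff_forall {n : ℕ} :
    EV B n X Y ↔ ∀ x : Abelian.Ext (ModuleCat.of B X) (ModuleCat.of B Y) n, x = 0 :=
  ⟨fun h _ => @Subsingleton.elim _ h _ _, fun h => ⟨fun a b => (h a).trans (h b).symm⟩⟩

lemma shortExact_of_linearMap {f : X₁ →ₗ[B] X₂} {g : X₂ →ₗ[B] X₃} (hf : Function.Injective f)
    (hfg : Function.Exact f g) (hg : Function.Surjective g) :
    (ModuleCat.shortComplexOfCompEqZero f g hfg.linearMap_comp_eq_zero).ShortExact :=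
  ModuleCat.shortComplex_shortExact _ hfg hf hg

section Sequences

variable {n : ℕ} {f : X₁ →ₗ[B] X₂} {g : X₂ →ₗ[B] X₃}

lemma EV.cov₁ (hf : Function.Injective f) (hfg : Function.Exact f g)
    (hg : Function.Surjective g) (h₃ : EV B n W X₃) (h₂ : EV B (n + 1) W X₂) : EV B (n + 1) W X₁ := by
  rw [EV.iff_forall] at *
  intro x
  obtain ⟨y, rfl⟩ := Abelian.Ext.covariant_sequence_exact₁ _
    (shortExact_of_linearMap hf hfg hg) x (h₂ _) rfl
  rw [h₃ y, Abelian.Ext.zero_comp]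

lemma EV.cov₂ (hf : Function.Injective f) (hfg : Function.Exact f g)
    (hg : Function.Surjective g) (h₁ : EV B n W X₁) (h₃ : EV B n W X₃) : EV B n W X₂ := by
  rw [EV.iff_forall] at *
  intro x
  obtain ⟨y, rfl⟩ := Abelian.Ext.covariant_sequence_exact₂ _
    (shortExact_of_linearMap hf hfg hg) x (h₃ _)
  rw [h₁ y, Abelian.Ext.zero_comp]

lemma EV.cov₃ (hf : Function.Injective f) (hfg : Function.Exact f g)
    (hg : Function.Surjective g) (h₂ : EV B n W X₂) (h₁ : EV B (n + 1) W X₁) : EV B n W X₃ := by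
  rw [EV.iff_forall] at *
  intro x
  obtain ⟨y, rfl⟩ := Abelian.Ext.covariant_sequence_exact₃ _
    (shortExact_of_linearMap hf hfg hg) x rfl (h₁ _)
  rw [h₂ y, Abelian.Ext.zero_comp]

lemma EV.con₁ (hf : Function.Injective f) (hfg : Function.Exact f g)
    (hg : Function.Surjective g) (h₂ : EV B n X₂ W) (h₃ : EV B (n + 1) X₃ W) : EV B n X₁ W := by
  rw [EV.iff_forall] at *
  intro x
  obtain ⟨y, rfl⟩ := Abelian.Ext.contravariant_sequence_exact₁
    (shortExact_of_linearMap hf hfg hg) _ x (add_comm 1 n) (h₃ _)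
  rw [h₂ y, Abelian.Ext.comp_zero]

lemma EV.con₂ (hf : Function.Injective f) (hfg : Function.Exact f g)
    (hg : Function.Surjective g) (h₁ : EV B n X₁ W) (h₃ : EV B n X₃ W) : EV B n X₂ W := by
  rw [EV.iff_forall] at *
  intro x
  obtain ⟨y, rfl⟩ := Abelian.Ext.contravariant_sequence_exact₂
    (shortExact_of_linearMap hf hfg hg) _ x (h₁ _)
  rw [h₃ y, Abelian.Ext.comp_zero]

lemma EV.con₃ (hf : Function.Injective f) (hfg : Function.Exact f g)
    (hg : Function.Surjective g) (h₁ : EV B n X₁ W) (h₂ : EV B (n + 1) X₂ W) : EV B (n + 1) X₃ W := by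
  rw [EV.iff_forall] at *
  intro x
  obtain ⟨y, rfl⟩ := Abelian.Ext.contravariant_sequence_exact₃
    (shortExact_of_linearMap hf hfg hg) _ x (h₂ _) (add_comm 1 n)
  rw [h₁ y, Abelian.Ext.comp_zero]

lemma EV.exists_lift (hf : Function.Injective f) (hfg : Function.Exact f g)
    (hg : Function.Surjective g) (h : EV B 1 W X₁) (φ : W →ₗ[B] X₃) : ∃ ψ : W →ₗ[B] X₂, g ∘ₗ ψ = φ := by
  rw [EV.iff_forall] at h
  obtain ⟨y, hy⟩ := Abelian.Ext.covariant_sequence_exact₃ (ModuleCat.of B W)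
    (shortExact_of_linearMap hf hfg hg) (Abelian.Ext.mk₀ (ModuleCat.ofHom φ)) rfl (h _)
  obtain ⟨ψ, rfl⟩ := Abelian.Ext.addEquiv₀.symm.surjective y
  refine ⟨ψ.hom, ?_⟩
  have := Abelian.Ext.mk₀_bijective _ _ |>.1 ((Abelian.Ext.mk₀_comp_mk₀ _ _).symm.trans hy)
  exact congrArg ModuleCat.Hom.hom this

lemma EV.exists_extend (hf : Function.Injective f) (hfg : Function.Exact f g)
    (hg : Function.Surjective g) (h : EV B 1 X₃ W) (φ : X₁ →ₗ[B] W) : ∃ ψ : X₂ →ₗ[B] W, ψ ∘ₗ f = φ := by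
  rw [EV.iff_forall] at h
  obtain ⟨y, hy⟩ := Abelian.Ext.contravariant_sequence_exact₁
    (shortExact_of_linearMap hf hfg hg) (ModuleCat.of B W)
    (Abelian.Ext.mk₀ (ModuleCat.ofHom φ)) rfl (h _)
  obtain ⟨ψ, rfl⟩ := Abelian.Ext.addEquiv₀.symm.surjective y
  refine ⟨ψ.hom, ?_⟩
  have := Abelian.Ext.mk₀_bijective _ _ |>.1 ((Abelian.Ext.mk₀_comp_mk₀ _ _).symm.trans hy)
  exact congrArg ModuleCat.Hom.hom this

lemma EV.one_of_extend (hf : Function.Injective f) (hfg : Function.Exact f g)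
    (hg : Function.Surjective g) (h₂ : EV B 1 X₂ W)
    (h : ∀ φ : X₁ →ₗ[B] W, ∃ ψ : X₂ →ₗ[B] W, ψ ∘ₗ f = φ) : EV B 1 X₃ W := by
  rw [EV.iff_forall] at *
  intro x
  have hS := shortExact_of_linearMap hf hfg hg
  obtain ⟨y, rfl⟩ := Abelian.Ext.contravariant_sequence_exact₃ hS _ x (h₂ _) (add_comm 1 0)
  obtain ⟨φ, rfl⟩ := Abelian.Ext.addEquiv₀.symm.surjective y
  obtain ⟨ψ, hψ⟩ := h φ.hom
  have : φ = ModuleCat.ofHom f ≫ ModuleCat.ofHom ψ := by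
    ext x
    exact (LinearMap.congr_fun hψ x).symm
  subst this
  have e : (Abelian.Ext.addEquiv₀.symm (ModuleCat.ofHom f ≫ ModuleCat.ofHom ψ) :
    Abelian.Ext _ _ 0) = (Abelian.Ext.mk₀ (ModuleCat.ofHom f)).comp
      (Abelian.Ext.mk₀ (ModuleCat.ofHom ψ)) (zero_add 0) := (Abelian.Ext.mk₀_comp_mk₀ _ _).symm
  rw [e]
  exact hS.extClass_comp_assoc _

end Sequences

lemma EV.of_sum {ι : Type*} [Fintype ι] {n : ℕ} {Y : ι → Type u} [∀ i, AddCommGroup (Y i)]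
    [∀ i, Module B (Y i)] (s : ∀ i, X →ₗ[B] Y i) (r : ∀ i, Y i →ₗ[B] X)
    (hsr : ∑ i, r i ∘ₗ s i = LinearMap.id) (h : ∀ i, EV B n (Y i) W) : EV B n X W := by
  simp only [EV.iff_forall] at *
  intro x
  have : (𝟙 (ModuleCat.of B X)) = ∑ i, ModuleCat.ofHom (s i) ≫ ModuleCat.ofHom (r i) := by
    ext x
    simpa [ModuleCat.hom_sum] using (LinearMap.congr_fun hsr x).symm
  rw [← Abelian.Ext.mk₀_id_comp x, this, Abelian.Ext.mk₀_sum, Abelian.Ext.sum_comp]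
  refine Finset.sum_eq_zero fun i _ => ?_
  rw [← Abelian.Ext.mk₀_comp_mk₀, Abelian.Ext.comp_assoc_of_second_deg_zero,
    h i ((Abelian.Ext.mk₀ _).comp x _), Abelian.Ext.comp_zero]

lemma EV.of_sum' {ι : Type} [Fintype ι] {n : ℕ} (s : ι → X →ₗ[B] Y) (r : ι → Y →ₗ[B] X)
    (hsr : ∑ i, r i ∘ₗ s i = LinearMap.id) (h : EV B n W Y) : EV B n W X := by
  rw [EV.iff_forall] at *
  intro x
  have : (𝟙 (ModuleCat.of B X)) = ∑ i, ModuleCat.ofHom (s i) ≫ ModuleCat.ofHom (r i) := by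
    ext x
    simpa [ModuleCat.hom_sum] using (LinearMap.congr_fun hsr x).symm
  rw [← Abelian.Ext.comp_mk₀_id x, this, Abelian.Ext.mk₀_sum, Abelian.Ext.comp_sum]
  refine Finset.sum_eq_zero fun i _ => ?_
  rw [← Abelian.Ext.mk₀_comp_mk₀, ← Abelian.Ext.comp_assoc_of_second_deg_zero,
    h (x.comp _ _), Abelian.Ext.zero_comp]

lemma EV.of_retract {n : ℕ} (s : X →ₗ[B] Y) (r : Y →ₗ[B] X) (h : r ∘ₗ s = LinearMap.id)
    (hY : EV B n Y W) : EV B n X W :=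
  EV.of_sum (ι := Unit) (fun _ => s) (fun _ => r) (by simpa using h) fun _ => hY

lemma EV.of_retract' {n : ℕ} (s : X →ₗ[B] Y) (r : Y →ₗ[B] X) (h : r ∘ₗ s = LinearMap.id)
    (hY : EV B n W Y) : EV B n W X :=
  EV.of_sum' (ι := Unit) (fun _ => s) (fun _ => r) (by simpa using h) hY

lemma EV.of_equiv {n : ℕ} (e : X ≃ₗ[B] Y) (hY : EV B n Y W) : EV B n X W :=
  EV.of_retract e.toLinearMap e.symm.toLinearMap (by ext; simp) hY

lemma EV.pi {n m : ℕ} (h : EV B n X W) : EV B n (Fin m → X) W :=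
  EV.of_sum (fun i => LinearMap.proj i) (fun i => LinearMap.single B (fun _ => X) i)
    (by ext; simp) fun _ => h

lemma EV.pi' {n m : ℕ} (h : EV B n W X) : EV B n W (Fin m → X) :=
  EV.of_sum' (fun i => LinearMap.proj i) (fun i => LinearMap.single B (fun _ => X) i)
    (by ext; simp) h

lemma EV.of_memAdd {n : ℕ} (h : MemAdd (ModuleCat.of B Y) (ModuleCat.of B X))
    (hY : EV B n Y W) : EV B n X W := by
  obtain ⟨m, f, g, hfg⟩ := h
  exact EV.of_retract f g hfg (EV.pi hY)

lemma EV.of_memAdd' {n : ℕ} (h : MemAdd (ModuleCat.of B Y) (ModuleCat.of B X))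
    (hY : EV B n W Y) : EV B n W X := by
  obtain ⟨m, f, g, hfg⟩ := h
  exact EV.of_retract' f g hfg (EV.pi' hY)

lemma EV.prod {n : ℕ} (hX : EV B n X W) (hY : EV B n Y W) : EV B n (X × Y) W :=
  EV.con₂ (f := LinearMap.inl B X Y) (g := LinearMap.snd B X Y) LinearMap.inl_injective
    .inl_snd LinearMap.snd_surjective hX hY

lemma EV.prod' {n : ℕ} (hX : EV B n W X) (hY : EV B n W Y) : EV B n W (X × Y) :=
  EV.cov₂ (f := LinearMap.inl B X Y) (g := LinearMap.snd B X Y) LinearMap.inl_injective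
    .inl_snd LinearMap.snd_surjective hX hY

lemma EV.of_projective [Module.Projective B X] {n : ℕ} : EV B (n + 1) X W := by
  rw [EV.iff_forall]
  intro x
  have : Projective (ModuleCat.of B X) :=
    (IsProjective.iff_projective (R := B) X).1 inferInstance
  exact x.eq_zero_of_projective

lemma EV.of_injective [Module.Injective B W] {n : ℕ} : EV B (n + 1) X W := by
  rw [EV.iff_forall]
  intro x
  have : Injective (ModuleCat.of B W) := Module.injective_object_of_injective_module B W
  exact x.eq_zero_of_injective

lemma EV.of_subsingleton [Subsingleton X] {n : ℕ} : EV B (n + 1) X W :=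
  EV.of_projective

lemma EV.of_subsingleton' [Subsingleton W] {n : ℕ} : EV B n X W := by
  rw [EV.iff_forall]
  intro x
  have : (𝟙 (ModuleCat.of B W)) = 0 := by
    ext x
    exact Subsingleton.elim _ _
  rw [← Abelian.Ext.comp_mk₀_id x, this, Abelian.Ext.mk₀_zero, Abelian.Ext.comp_zero]

end ExtVanish

section ProjDim

variable {B : Type u} [Ring B]

/-- `Ext^n_B(X, -) = 0` for all `n > d`. -/
def PdLE (B : Type u) [Ring B] (d : ℕ) (X : Type u) [AddCommGroup X] [Module B X] : Prop :=
  ∀ (Y : Type u) [AddCommGroup Y] [Module B Y] (n : ℕ), d < n → EV B n X Y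

variable {X X₁ X₂ X₃ Y : Type u} [AddCommGroup X] [Module B X]
  [AddCommGroup X₁] [Module B X₁] [AddCommGroup X₂] [Module B X₂]
  [AddCommGroup X₃] [Module B X₃] [AddCommGroup Y] [Module B Y]

lemma exact_ker_subtype (f : X →ₗ[B] Y) :
    Function.Exact (LinearMap.ker f).subtype f :=
  LinearMap.exact_subtype_ker_map f

lemma pdLE_of_projDimLE : ∀ (d : ℕ) (X : ModuleCat.{u} B), ProjDimLE X d → PdLE B d X
  | 0, X, h => by
    intro Y _ _ n hn
    obtain ⟨n, rfl⟩ := Nat.exists_eq_succ_of_ne_zero hn.ne'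
    have : Module.Projective B X := h
    exact EV.of_projective
  | d + 1, X, h => by
    obtain ⟨P, hP, f, hf, hk⟩ := h
    intro Y _ _ n hn
    obtain ⟨n, rfl⟩ := Nat.exists_eq_add_of_lt hn
    exact EV.con₃ (Submodule.subtype_injective _) (exact_ker_subtype f) hf
      (pdLE_of_projDimLE d _ hk Y _ (by omega)) EV.of_projective

lemma projDimLE_of_forall : ∀ (d : ℕ) (X : Type u) [AddCommGroup X] [Module B X],
    (∀ (Y : Type u) [AddCommGroup Y] [Module B Y], EV B (d + 1) X Y) →
    ProjDimLE (ModuleCat.of B X) d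
  | 0, X, _, _, h => by
    let f : (X →₀ B) →ₗ[B] X := Finsupp.linearCombination B id
    have hf : Function.Surjective f := Finsupp.linearCombination_id_surjective B X
    obtain ⟨s, hs⟩ := EV.exists_lift (Submodule.subtype_injective _) (exact_ker_subtype f) hf
      (h _) LinearMap.id
    exact Module.Projective.of_split s f hs
  | d + 1, X, _, _, h => by
    let f : (X →₀ B) →ₗ[B] X := Finsupp.linearCombination B id
    have hf : Function.Surjective f := Finsupp.linearCombination_id_surjective B X
    refine ⟨ModuleCat.of B (X →₀ B), inferInstanceAs (Module.Projective B (X →₀ B)), f, hf, ?_⟩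
    refine projDimLE_of_forall d _ fun Y _ _ => ?_
    exact EV.con₁ (Submodule.subtype_injective _) (exact_ker_subtype f) hf
      EV.of_projective (h Y)

lemma hasFiniteProjDim_iff : HasFiniteProjDim (ModuleCat.of B X) ↔ ∃ d, PdLE B d X :=
  ⟨fun ⟨d, h⟩ => ⟨d, pdLE_of_projDimLE d _ h⟩,
    fun ⟨d, h⟩ => ⟨d, projDimLE_of_forall d X fun Y _ _ => h Y _ d.lt_succ_self⟩⟩

lemma PdLE.prod {d : ℕ} (h : PdLE B d X) (h' : PdLE B d Y) : PdLE B d (X × Y) :=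
  fun W _ _ n hn => EV.prod (h W n hn) (h' W n hn)

lemma PdLE.pi {d m : ℕ} (h : PdLE B d X) : PdLE B d (Fin m → X) :=
  fun W _ _ n hn => EV.pi (h W n hn)

lemma PdLE.ext {d : ℕ} {f : X₁ →ₗ[B] X₂} {g : X₂ →ₗ[B] X₃} (hf : Function.Injective f)
    (hfg : Function.Exact f g) (hg : Function.Surjective g) (h₁ : PdLE B d X₁)
    (h₃ : PdLE B d X₃) : PdLE B d X₂ :=
  fun W _ _ n hn => EV.con₂ hf hfg hg (h₁ W n hn) (h₃ W n hn)

end ProjDim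

section Bongartz

variable {B : Type u} [Ring B]
variable {X X₁ X₂ X₃ Y : Type u} [AddCommGroup X] [Module B X]
  [AddCommGroup X₁] [Module B X₁] [AddCommGroup X₂] [Module B X₂]
  [AddCommGroup X₃] [Module B X₃] [AddCommGroup Y] [Module B Y]

lemma exists_factor {f : X₁ →ₗ[B] X₂} {g : X₂ →ₗ[B] X₃} (hf : Function.Injective f)
    (hfg : Function.Exact f g) (φ : Y →ₗ[B] X₂) (h : ∀ y, g (φ y) = 0) :
    ∃ ψ : Y →ₗ[B] X₁, ∀ y, f (ψ y) = φ y := by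
  have : ∀ y, φ y ∈ LinearMap.range f := fun y => (hfg (φ y)).1 (h y)
  refine ⟨(LinearEquiv.ofInjective f hf).symm.toLinearMap ∘ₗ φ.codRestrict _ this, fun y => ?_⟩
  have := LinearEquiv.apply_symm_apply (LinearEquiv.ofInjective f hf) ⟨φ y, this y⟩
  exact congrArg Subtype.val this

lemma exists_factor_surj {f : X₁ →ₗ[B] X₂} {g : X₂ →ₗ[B] X₃}
    (hfg : Function.Exact f g) (hg : Function.Surjective g) (φ : X₂ →ₗ[B] Y)
    (h : ∀ x, φ (f x) = 0) : ∃ ψ : X₃ →ₗ[B] Y, ∀ x, ψ (g x) = φ x := by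
  have hk : LinearMap.ker g ≤ LinearMap.ker φ := by
    intro x hx
    obtain ⟨y, rfl⟩ := (hfg x).1 hx
    exact h y
  refine ⟨(LinearMap.ker g).liftQ φ hk ∘ₗ (g.quotKerEquivOfSurjective hg).symm.toLinearMap,
    fun x => ?_⟩
  have : (g.quotKerEquivOfSurjective hg).symm (g x) = (LinearMap.ker g).mkQ x := by
    rw [LinearEquiv.symm_apply_eq]
    rfl
  simp [this]

lemma exists_pushout {f : X₁ →ₗ[B] X₂} {g : X₂ →ₗ[B] X₃} (hf : Function.Injective f)
    (hfg : Function.Exact f g) (hg : Function.Surjective g) (φ : X₁ →ₗ[B] Y) :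
    ∃ (E : ModuleCat.{u} B) (i : Y →ₗ[B] E) (p : E →ₗ[B] X₃) (ψ : X₂ →ₗ[B] E),
      Function.Injective i ∧ Function.Exact i p ∧ Function.Surjective p ∧
      (∀ x, ψ (f x) = i (φ x)) ∧ Function.Exact ((-φ).prod f) (i.coprod ψ) ∧
      Function.Surjective (i.coprod ψ) := by
  let j : X₁ →ₗ[B] Y × X₂ := (-φ).prod f
  have hker : LinearMap.range j ≤ LinearMap.ker (g ∘ₗ LinearMap.snd B Y X₂) := by
    rintro _ ⟨x, rfl⟩
    exact hfg.apply_apply_eq_zero x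
  refine ⟨ModuleCat.of B ((Y × X₂) ⧸ LinearMap.range j),
    (LinearMap.range j).mkQ ∘ₗ LinearMap.inl B Y X₂,
    (LinearMap.range j).liftQ (g ∘ₗ LinearMap.snd B Y X₂) hker,
    (LinearMap.range j).mkQ ∘ₗ LinearMap.inr B Y X₂, ?_, ?_, ?_, ?_, ?_⟩
  · rw [injective_iff_map_eq_zero]
    intro y hy
    obtain ⟨x, hx⟩ := (Submodule.Quotient.mk_eq_zero _).1 hy
    have h1 : f x = 0 := congrArg Prod.snd hx
    have h2 : -φ x = y := congrArg Prod.fst hx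
    rw [← h2, (map_eq_zero_iff f hf).1 h1, map_zero, neg_zero]
  · intro e
    constructor
    · intro he
      obtain ⟨⟨y, x⟩, rfl⟩ := (LinearMap.range j).mkQ_surjective e
      have hx : g x = 0 := he
      obtain ⟨z, rfl⟩ := (hfg x).1 hx
      refine ⟨y + φ z, ((Submodule.Quotient.eq _).2 ⟨-z, ?_⟩)⟩
      simp [j]
    · rintro ⟨y, rfl⟩
      exact map_zero g
  · intro x
    obtain ⟨y, rfl⟩ := hg x
    exact ⟨(LinearMap.range j).mkQ (0, y), rfl⟩
  · intro x
    exact (Submodule.Quotient.eq _).2 ⟨x, by simp [j]⟩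
  · have : (LinearMap.range j).mkQ = ((LinearMap.range j).mkQ ∘ₗ LinearMap.inl B Y X₂).coprod
        ((LinearMap.range j).mkQ ∘ₗ LinearMap.inr B Y X₂) := by
      ext <;> simp
    rw [← this]
    exact ⟨LinearMap.exact_map_mkQ_range j, (LinearMap.range j).mkQ_surjective⟩

lemma memAdd_of_retract {T X : ModuleCat.{u} B} {n : ℕ} (f : X →ₗ[B] (Fin n → T))
    (g : (Fin n → T) →ₗ[B] X) (h : ∀ x, g (f x) = x) : MemAdd T X :=
  ⟨n, f, g, LinearMap.ext h⟩

lemma MemAdd.of_equiv {T X Y : ModuleCat.{u} B} (h : MemAdd T X) (e : X ≃ₗ[B] Y) :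
    MemAdd T Y := by
  obtain ⟨n, f, g, hfg⟩ := h
  refine ⟨n, f ∘ₗ e.symm.toLinearMap, e.toLinearMap ∘ₗ g, ?_⟩
  ext y
  simpa using congrArg e (LinearMap.congr_fun hfg (e.symm y))

lemma CoresolvedBy.of_equiv {T : ModuleCat.{u} B} : ∀ {d : ℕ} {X Y : ModuleCat.{u} B},
    CoresolvedBy T X d → (X ≃ₗ[B] Y) → CoresolvedBy T Y d
  | 0, X, Y, h, e => MemAdd.of_equiv (X := X) h e
  | d + 1, X, Y, ⟨T₀, hT, f, hf, hc⟩, e => by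
    refine ⟨T₀, hT, f ∘ₗ e.symm.toLinearMap, hf.comp e.symm.injective, ?_⟩
    have : LinearMap.range (f ∘ₗ e.symm.toLinearMap) = LinearMap.range f := by
      rw [LinearMap.range_comp, LinearEquiv.range, Submodule.map_top]
    rw [this]
    exact hc

lemma CoresolvedBy.of_exact {T : ModuleCat.{u} B} {d : ℕ} {X₁ X₂ X₃ : ModuleCat.{u} B}
    {f : X₁ →ₗ[B] X₂} {g : X₂ →ₗ[B] X₃} (hf : Function.Injective f)
    (hfg : Function.Exact f g) (hg : Function.Surjective g) (h₂ : MemAdd T X₂)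
    (h₃ : CoresolvedBy T X₃ d) : CoresolvedBy T X₁ (d + 1) := by
  refine ⟨X₂, h₂, f, hf, CoresolvedBy.of_equiv (X := X₃) h₃ ?_⟩
  refine ((Submodule.quotEquivOfEq _ _ ?_).trans (g.quotKerEquivOfSurjective hg)).symm
  exact (LinearMap.exact_iff.1 hfg).symm

variable {k : Type u} [Field k] [Algebra k B]

/-- Multiplication by a scalar, as an endomorphism of a module over a `k`-algebra. -/
def scalarEnd (B : Type u) [Ring B] [Algebra k B] (X : Type u) [AddCommGroup X] [Module B X]
    (c : k) : X →ₗ[B] X where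
  toFun x := algebraMap k B c • x
  map_add' := smul_add _
  map_smul' b x := by
    rw [RingHom.id_apply, ← mul_smul, ← mul_smul, Algebra.commutes]

lemma scalarEnd_apply (c : k) (x : X) : scalarEnd B X c x = algebraMap k B c • x := rfl

variable (k) in
lemma exists_hom_generators [Module.Finite k B] [Module.Finite B X] [Module.Finite B Y] :
    ∃ (m : ℕ) (h : Fin m → X →ₗ[B] Y), ∀ φ : X →ₗ[B] Y, ∃ c : Fin m → k,
      ∀ x, φ x = ∑ i, h i (scalarEnd B X (c i) x) := by
  let _ : Module k X := Module.compHom X (algebraMap k B)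
  let _ : Module k Y := Module.compHom Y (algebraMap k B)
  have : IsScalarTower k B X := ⟨fun a b x => by
    rw [Algebra.smul_def, mul_smul]; rfl⟩
  have : IsScalarTower k B Y := ⟨fun a b x => by
    rw [Algebra.smul_def, mul_smul]; rfl⟩
  have : Module.Finite k X := Module.Finite.trans B X
  have : Module.Finite k Y := Module.Finite.trans B Y
  have : Module.Finite k (X →ₗ[B] Y) :=
    Module.Finite.of_injective (LinearMap.restrictScalarsₗ k B X Y k)
      (LinearMap.restrictScalars_injective k)
  obtain ⟨m, h, hh⟩ := Module.Finite.exists_fin (R := k) (M := X →ₗ[B] Y)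
  refine ⟨m, h, fun φ => ?_⟩
  have hφ : φ ∈ Submodule.span k (Set.range h) := hh ▸ Submodule.mem_top
  obtain ⟨c, rfl⟩ := (Submodule.mem_span_range_iff_exists_fun k).1 hφ
  refine ⟨c, fun x => ?_⟩
  simp only [LinearMap.sum_apply, LinearMap.smul_apply, scalarEnd_apply, map_smul]
  rfl

lemma finite_of_exact [IsNoetherianRing B] [Module.Finite B X₁] [Module.Finite B X₃]
    {f : X₁ →ₗ[B] X₂} {g : X₂ →ₗ[B] X₃}
    (hfg : Function.Exact f g) : Module.Finite B X₂ := by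
  have : IsNoetherian B X₂ := isNoetherian_of_range_eq_ker f g (LinearMap.exact_iff.1 hfg).symm
  infer_instance

variable {M : Type u} [AddCommGroup M] [Module B M]

variable (k) in
lemma bongartz [Module.Finite k B] [Module.Finite B M] {d : ℕ} (hd : PdLE B d M)
    (hM : ∀ n, EV B (n + 1) M M) (hB : ∀ n, EV B (n + 2) M B) :
    ∃ N : ModuleCat.{u} B, Module.Finite B N ∧ IsTilting (dSum (ModuleCat.of B M) N) := by
  have : IsNoetherianRing B := IsNoetherianRing.of_finite k B
  obtain ⟨n, p, hp⟩ := Module.Finite.exists_fin' B M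
  obtain ⟨m, h, hh⟩ := exists_hom_generators k (B := B) (X := LinearMap.ker p) (Y := B)
  let i := (LinearMap.ker p).subtype
  have hi : Function.Injective i := Submodule.subtype_injective _
  have hip : Function.Exact i p := exact_ker_subtype p
  let iM : (Fin m → LinearMap.ker p) →ₗ[B] (Fin m → Fin n → B) := i.compLeft (Fin m)
  let pM : (Fin m → Fin n → B) →ₗ[B] (Fin m → M) := p.compLeft (Fin m)
  have hiM : Function.Injective iM := fun a b hab => funext fun t => hi (congrFun hab t)
  have hpM : Function.Surjective pM := fun a => by
    choose q hq using fun t => hp (a t)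
    exact ⟨q, funext hq⟩
  have hipM : Function.Exact iM pM := fun a => by
    constructor
    · intro ha
      choose q hq using fun t => (hip (a t)).1 (congrFun ha t)
      exact ⟨q, funext hq⟩
    · rintro ⟨q, rfl⟩
      exact funext fun t => hip.apply_apply_eq_zero (q t)
  obtain ⟨E, ι, π, ψ, hι, hιπ, hπ, hψ, -⟩ := exists_pushout hiM hipM hpM
    (∑ t, h t ∘ₗ LinearMap.proj t)
  have hME1 : EV B 1 M E := by
    refine EV.one_of_extend hi hip hp EV.of_projective fun φ => ?_
    obtain ⟨β, hβ⟩ := EV.exists_extend hi hip hp (EV.pi' (hM 0)) (π ∘ₗ φ)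
    obtain ⟨α, hα⟩ := Module.projective_lifting_property π β hπ
    obtain ⟨γ, hγ⟩ := exists_factor hι hιπ (φ - α ∘ₗ i) fun y => by
      have h1 := LinearMap.congr_fun hβ y
      have h2 := LinearMap.congr_fun hα (i y)
      simp only [LinearMap.comp_apply] at h1 h2
      simp [h1, h2]
    obtain ⟨c, hc⟩ := hh γ
    refine ⟨α + ∑ t, ψ ∘ₗ LinearMap.single B (fun _ => Fin n → B) t ∘ₗ
      scalarEnd B (Fin n → B) (c t), ?_⟩
    ext y
    have h3 : φ y = α (i y) + ι (γ y) := by simp [hγ]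
    rw [h3, hc]
    simp only [LinearMap.comp_apply, LinearMap.add_apply, LinearMap.sum_apply, map_sum]
    congr 1
    refine Finset.sum_congr rfl fun t _ => ?_
    have h4 : iM (Pi.single t (scalarEnd B _ (c t) y)) =
        Pi.single t (scalarEnd B _ (c t) (i y)) := by
      funext s
      by_cases hs : s = t
      · subst hs
        simp [iM, scalarEnd_apply]
      · simp [iM, hs]
    rw [LinearMap.single_apply, ← h4, hψ]
    congr 1
    rw [LinearMap.sum_apply, Finset.sum_eq_single t]
    · simp
    · intro s _ hs
      simp [hs]
    · simp
  have hME : ∀ n, EV B (n + 1) M E := fun n => by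
    cases n with
    | zero => exact hME1
    | succ n => exact EV.cov₂ hι hιπ hπ (hB n) (EV.pi' (hM _))
  have hEE : ∀ n, EV B (n + 1) E E := fun n =>
    EV.con₂ hι hιπ hπ EV.of_projective (EV.pi (hME n))
  have hEM : ∀ n, EV B (n + 1) E M := fun n =>
    EV.con₂ hι hιπ hπ EV.of_projective (EV.pi (hM n))
  have hBd : PdLE B d B := fun Y _ _ n hn => by
    obtain ⟨n, rfl⟩ := Nat.exists_eq_succ_of_ne_zero (Nat.zero_lt_of_lt hn).ne'
    exact EV.of_projective
  refine ⟨E, finite_of_exact hιπ, hasFiniteProjDim_iff.2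
    ⟨d, hd.prod (PdLE.ext hι hιπ hπ hBd hd.pi)⟩, fun n hn => ?_, 1, ?_⟩
  · obtain ⟨n, rfl⟩ := Nat.exists_eq_succ_of_ne_zero hn.ne'
    exact EV.prod (EV.prod' (hM n) (hME n)) (EV.prod' (hEM n) (hEE n))
  · refine CoresolvedBy.of_exact (X₁ := ModuleCat.of B B) (X₂ := E)
      (X₃ := ModuleCat.of B (Fin m → M)) hι hιπ hπ ?_ ?_
    · exact memAdd_of_retract (n := 1) (LinearMap.pi fun _ => LinearMap.inr B M E)
        (LinearMap.snd B M E ∘ₗ LinearMap.proj 0) fun x => rfl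
    · exact memAdd_of_retract (n := m) ((LinearMap.inl B M E).compLeft (Fin m))
        ((LinearMap.fst B M E).compLeft (Fin m)) fun x => rfl

end Bongartz

section DualBongartz

variable {B : Type u} [Ring B]
variable {X X₁ X₂ X₃ Y : Type u} [AddCommGroup X] [Module B X]
  [AddCommGroup X₁] [Module B X₁] [AddCommGroup X₂] [Module B X₂]
  [AddCommGroup X₃] [Module B X₃] [AddCommGroup Y] [Module B Y]

section MemAdd

variable {T : ModuleCat.{u} B}

lemma MemAdd.of_fintype {X : ModuleCat.{u} B} {ι : Type} [Fintype ι] (f : X →ₗ[B] (ι → T))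
    (g : (ι → T) →ₗ[B] X) (h : ∀ x, g (f x) = x) : MemAdd T X := by
  let e := LinearEquiv.funCongrLeft B T (Fintype.equivFin ι)
  exact memAdd_of_retract (e.symm.toLinearMap ∘ₗ f) (g ∘ₗ e.toLinearMap) fun x => by simp [h]

lemma MemAdd.retract {X Y : ModuleCat.{u} B} (h : MemAdd T Y) (s : X →ₗ[B] Y) (r : Y →ₗ[B] X)
    (hrs : ∀ x, r (s x) = x) : MemAdd T X := by
  obtain ⟨n, f, g, hfg⟩ := h
  refine memAdd_of_retract (f ∘ₗ s) (r ∘ₗ g) fun x => ?_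
  have := LinearMap.congr_fun hfg (s x)
  simp only [LinearMap.comp_apply, LinearMap.id_apply] at this ⊢
  rw [this, hrs]

lemma MemAdd.prod {X Y : ModuleCat.{u} B} (hX : MemAdd T X) (hY : MemAdd T Y) :
    MemAdd T (ModuleCat.of B (X × Y)) := by
  obtain ⟨n, f, g, hfg⟩ := hX
  obtain ⟨m, f', g', hfg'⟩ := hY
  let e := LinearEquiv.sumArrowLequivProdArrow (Fin n) (Fin m) B T
  refine MemAdd.of_fintype (ι := Fin n ⊕ Fin m)
    (e.symm.toLinearMap ∘ₗ (f.prodMap f')) ((g.prodMap g') ∘ₗ e.toLinearMap) ?_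
  rintro ⟨x, y⟩
  have h1 := LinearMap.congr_fun hfg x
  have h2 := LinearMap.congr_fun hfg' y
  simp only [LinearMap.comp_apply, LinearMap.id_apply] at h1 h2
  simp [h1, h2]

lemma memAdd_of_subsingleton {X : ModuleCat.{u} B} [Subsingleton X] : MemAdd T X :=
  memAdd_of_retract (n := 0) 0 0 fun _ => Subsingleton.elim _ _

end MemAdd

/-- `Y` is right orthogonal to `T` and has an exact resolution by `add T` of length `N`, all
syzygies being right orthogonal to `T`. -/
def GenBy (T : ModuleCat.{u} B) : ℕ → ModuleCat.{u} B → Prop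
  | 0, Y => ∀ i, EV B (i + 1) T Y
  | N + 1, Y => (∀ i, EV B (i + 1) T Y) ∧
      ∃ (T₀ Z : ModuleCat.{u} B) (f : Z →ₗ[B] T₀) (g : T₀ →ₗ[B] Y),
        Function.Injective f ∧ Function.Exact f g ∧ Function.Surjective g ∧
        MemAdd T T₀ ∧ GenBy T N Z

namespace GenBy

variable {T : ModuleCat.{u} B}

lemma perp : ∀ {N : ℕ} {Y : ModuleCat.{u} B}, GenBy T N Y → ∀ i, EV B (i + 1) T Y
  | 0, _, h => h
  | _ + 1, _, h => h.1

lemma pred : ∀ {N : ℕ} {Y : ModuleCat.{u} B}, GenBy T (N + 1) Y → GenBy T N Y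
  | 0, _, h => h.1
  | _ + 1, _, ⟨h, T₀, Z, f, g, hf, hfg, hg, hT, hZ⟩ => ⟨h, T₀, Z, f, g, hf, hfg, hg, hT, hZ.pred⟩

lemma of_subsingleton : ∀ {N : ℕ} {Y : ModuleCat.{u} B} [Subsingleton Y], GenBy T N Y
  | 0, _, _ => fun _ => EV.of_subsingleton'
  | N + 1, Y, _ => ⟨fun _ => EV.of_subsingleton', Y, ModuleCat.of B PUnit, 0, 0,
      fun _ _ _ => rfl, fun _ => by simp [Subsingleton.elim _ (0 : Y)],
      fun _ => ⟨0, Subsingleton.elim _ _⟩, memAdd_of_subsingleton, of_subsingleton⟩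

lemma of_memAdd (hT : ∀ i, EV B (i + 1) T T) {N : ℕ} {X : ModuleCat.{u} B} (h : MemAdd T X) :
    GenBy T N X := by
  have hp : ∀ i, EV B (i + 1) T X := fun i => EV.of_memAdd' h (hT i)
  cases N with
  | zero => exact hp
  | succ N =>
    refine ⟨hp, X, ModuleCat.of B PUnit, 0, LinearMap.id, fun _ _ _ => rfl, fun x => ?_,
      Function.surjective_id, h, of_subsingleton⟩
    simpa using eq_comm

lemma ext : ∀ {N : ℕ} {Y₁ Y₂ Y₃ : ModuleCat.{u} B} {f : Y₁ →ₗ[B] Y₂} {g : Y₂ →ₗ[B] Y₃},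
    Function.Injective f → Function.Exact f g → Function.Surjective g →
    GenBy T N Y₁ → GenBy T N Y₃ → GenBy T N Y₂
  | 0, _, _, _, _, _, hf, hfg, hg, h₁, h₃ => fun i => EV.cov₂ hf hfg hg (h₁ i) (h₃ i)
  | N + 1, Y₁, Y₂, Y₃, f, g, hf, hfg, hg, ⟨h₁, T₁, Z₁, f₁, g₁, hf₁, hfg₁, hg₁, hT₁, hZ₁⟩,
      ⟨h₃, T₃, Z₃, f₃, g₃, hf₃, hfg₃, hg₃, hT₃, hZ₃⟩ => by
    obtain ⟨l, hl⟩ := EV.exists_lift hf hfg hg (EV.of_memAdd hT₃ (h₁ 0)) g₃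
    replace hl : ∀ b, g (l b) = g₃ b := LinearMap.congr_fun hl
    let q : (T₁ × T₃) →ₗ[B] Y₂ := (f ∘ₗ g₁).coprod l
    have hq : ∀ a b, q (a, b) = f (g₁ a) + l b := fun a b => rfl
    refine ⟨fun i => EV.cov₂ hf hfg hg (h₁ i) (h₃ i), ModuleCat.of B (T₁ × T₃),
      ModuleCat.of B (LinearMap.ker q), (LinearMap.ker q).subtype, q,
      Submodule.subtype_injective _, exact_ker_subtype q, ?_, hT₁.prod hT₃, ?_⟩
    · intro y
      obtain ⟨b, hb⟩ := hg₃ (g y)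
      obtain ⟨x, hx⟩ := (hfg (y - l b)).1 (by rw [map_sub, hl, hb, sub_self])
      obtain ⟨a, rfl⟩ := hg₁ x
      exact ⟨(a, b), by rw [hq, hx, sub_add_cancel]⟩
    · obtain ⟨γ, hγ⟩ := exists_factor hf₃ hfg₃
        (LinearMap.snd B T₁ T₃ ∘ₗ (LinearMap.ker q).subtype) (by
          rintro ⟨⟨a, b⟩, hab⟩
          have h : f (g₁ a) + l b = 0 := hab
          have := congrArg g h
          rwa [map_add, hfg.apply_apply_eq_zero, hl, zero_add, map_zero] at this)
      let δ : Z₁ →ₗ[B] LinearMap.ker q :=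
        (LinearMap.inl B T₁ T₃ ∘ₗ f₁).codRestrict _ fun z => by
          change f (g₁ (f₁ z)) + l 0 = 0
          rw [hfg₁.apply_apply_eq_zero, map_zero, map_zero, add_zero]
      refine ext (Y₁ := Z₁) (Y₂ := ModuleCat.of B (LinearMap.ker q)) (Y₃ := Z₃)
        (f := δ) (g := γ) ?_ ?_ ?_ hZ₁ hZ₃
      · intro x y hxy
        exact hf₁ (congrArg (fun z : LinearMap.ker q => z.1.1) hxy)
      · rintro ⟨⟨a, b⟩, hab⟩
        constructor
        · intro h
          have hb : f₃ (γ ⟨(a, b), hab⟩) = b := hγ _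
          rw [h, map_zero] at hb
          subst hb
          have h' : f (g₁ a) + l 0 = 0 := hab
          rw [map_zero, add_zero, map_eq_zero_iff f hf] at h'
          obtain ⟨z, rfl⟩ := (hfg₁ a).1 h'
          exact ⟨z, rfl⟩
        · rintro ⟨z, hz⟩
          have hb : f₃ (γ ⟨(a, b), hab⟩) = b := hγ _
          have : (0 : T₃) = b := congrArg (fun z : LinearMap.ker q => z.1.2) hz
          exact (map_eq_zero_iff f₃ hf₃).1 (hb.trans this.symm)
      · intro z
        obtain ⟨x, hx⟩ := (hfg (l (f₃ z))).1 (by rw [hl, hfg₃.apply_apply_eq_zero])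
        obtain ⟨a, rfl⟩ := hg₁ x
        refine ⟨⟨(-a, f₃ z), ?_⟩, hf₃ (hγ _)⟩
        change f (g₁ (-a)) + l (f₃ z) = 0
        rw [map_neg, map_neg, hx, neg_add_cancel]

lemma retract : ∀ {N : ℕ} {X Y : ModuleCat.{u} B} (s : X →ₗ[B] Y) (r : Y →ₗ[B] X),
    (∀ x, r (s x) = x) → GenBy T N Y → GenBy T N X
  | 0, _, _, s, r, h, hY => fun i => EV.of_retract' s r (LinearMap.ext h) (hY i)
  | N + 1, X, Y, s, r, h, hY => by
    refine ⟨fun i => EV.of_retract' s r (LinearMap.ext h) (hY.perp i), ?_⟩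
    have hN := hY.pred
    obtain ⟨-, T₀, Z, f, g, hf, hfg, hg, hT, hZ⟩ := hY
    refine ⟨T₀, ModuleCat.of B (LinearMap.ker (r ∘ₗ g)), (LinearMap.ker (r ∘ₗ g)).subtype, r ∘ₗ g,
      Submodule.subtype_injective _, exact_ker_subtype _, ?_, hT, ?_⟩
    · exact (Function.LeftInverse.surjective h).comp hg
    · have hk : GenBy T N (ModuleCat.of B (LinearMap.ker r)) :=
        retract (X := ModuleCat.of B (LinearMap.ker r)) (Y := Y) (LinearMap.ker r).subtype
          ((LinearMap.id - s ∘ₗ r).codRestrict _ fun y => by simp [h])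
          (by rintro ⟨y, hy⟩; ext; simpa using (by rw [LinearMap.mem_ker.1 hy, map_zero])) hN
      refine ext (Y₁ := Z) (Y₂ := ModuleCat.of B (LinearMap.ker (r ∘ₗ g)))
        (Y₃ := ModuleCat.of B (LinearMap.ker r))
        (f := f.codRestrict _ fun z => by simp [hfg.apply_apply_eq_zero])
        (g := (g ∘ₗ (LinearMap.ker (r ∘ₗ g)).subtype).codRestrict _ fun z => z.2) ?_ ?_ ?_ hZ hk
      · intro a b hab
        exact hf (congrArg Subtype.val hab)
      · rintro ⟨a, ha⟩
        constructor
        · intro h0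
          obtain ⟨z, rfl⟩ := (hfg a).1 (congrArg Subtype.val h0)
          exact ⟨z, rfl⟩
        · rintro ⟨z, hz⟩
          have : f z = a := congrArg Subtype.val hz
          subst this
          exact Subtype.ext (hfg.apply_apply_eq_zero z)
      · rintro ⟨y, hy⟩
        obtain ⟨a, rfl⟩ := hg y
        exact ⟨⟨a, hy⟩, rfl⟩

lemma pi {N : ℕ} {Y : ModuleCat.{u} B} (h : GenBy T N Y) :
    ∀ n : ℕ, GenBy T N (ModuleCat.of B (Fin n → Y))
  | 0 => of_subsingleton
  | n + 1 => by
    refine ext (Y₁ := Y) (Y₂ := ModuleCat.of B (Fin (n + 1) → Y))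
      (Y₃ := ModuleCat.of B (Fin n → Y)) (f := LinearMap.single B (fun _ => Y) 0)
      (g := LinearMap.funLeft B Y Fin.succ) ?_ ?_ ?_ h (pi h n)
    · intro a b hab
      simpa using congrFun hab 0
    · intro a
      constructor
      · intro ha
        refine ⟨a 0, funext fun i => ?_⟩
        refine Fin.cases ?_ (fun j => ?_) i
        · simp
        · have : a j.succ = 0 := congrFun ha j
          simp [this]
      · rintro ⟨y, rfl⟩
        funext i
        simp only [LinearMap.funLeft_apply, LinearMap.single_apply]
        exact Pi.single_eq_of_ne (Fin.succ_ne_zero i) y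
    · exact LinearMap.funLeft_surjective_of_injective B Y _ (Fin.succ_injective n)

lemma of_memAdd_of {N : ℕ} {I X : ModuleCat.{u} B} (hI : GenBy T N I) (h : MemAdd I X) :
    GenBy T N X := by
  obtain ⟨n, f, g, hfg⟩ := h
  exact retract (Y := ModuleCat.of B (Fin n → I)) f g (LinearMap.congr_fun hfg) (hI.pi n)

lemma ev_of_le {Y : Type u} [AddCommGroup Y] [Module B Y] {t : ℕ} (hY : PdLE B t Y)
    (hYT : ∀ i, EV B (i + 1) Y T) : ∀ {N : ℕ} {Z : ModuleCat.{u} B} (j : ℕ), GenBy T N Z →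
    t ≤ j + N → EV B (j + 1) Y Z
  | 0, Z, j, _, h => hY Z _ (by omega)
  | N + 1, Z, j, ⟨_, T₀, Z', f, g, hf, hfg, hg, hT, hZ⟩, h =>
    EV.cov₃ hf hfg hg (EV.of_memAdd' hT (hYT j)) (ev_of_le hY hYT (j + 1) hZ (by omega))

end GenBy

lemma exists_genBy_of_coresolvedBy {T I : ModuleCat.{u} B} (hI : ∀ N, GenBy T N I) :
    ∀ {d : ℕ} {C : ModuleCat.{u} B}, CoresolvedBy I C d → ∀ N : ℕ,
    ∃ (Y X : ModuleCat.{u} B) (f : C →ₗ[B] Y) (g : Y →ₗ[B] X), Function.Injective f ∧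
      Function.Exact f g ∧ Function.Surjective g ∧ GenBy T N Y ∧ ∃ e, CoresolvedBy T X e
  | 0, C, h, N => ⟨C, ModuleCat.of B PUnit, LinearMap.id, 0, Function.injective_id,
      fun x => by simp, fun x => ⟨0, Subsingleton.elim _ _⟩, (hI N).of_memAdd_of h, 0,
      memAdd_of_subsingleton⟩
  | d + 1, C, ⟨Y₀, hY₀, i, hi, hc⟩, N => by
    obtain ⟨Y', X', j, q, hj, hjq, hq, ⟨-, T₀, Z, f, g, hf, hfg, hg, hT₀, hZ⟩, e, he⟩ :=
      exists_genBy_of_coresolvedBy hI hc (N + 1)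
    let π := (LinearMap.range i).mkQ
    have hiπ : Function.Exact i π := LinearMap.exact_map_mkQ_range i
    have hπ : Function.Surjective π := (LinearMap.range i).mkQ_surjective
    let P := LinearMap.ker (q ∘ₗ g)
    let E : Submodule B (Y₀ × T₀) :=
      LinearMap.ker ((j ∘ₗ π ∘ₗ LinearMap.fst B Y₀ T₀) - (g ∘ₗ LinearMap.snd B Y₀ T₀))
    have hE : ∀ y t, (y, t) ∈ E ↔ j (π y) = g t := fun y t => by
      simp [E, sub_eq_zero]
    refine ⟨ModuleCat.of B E, ModuleCat.of B P,
      (LinearMap.inl B Y₀ T₀ ∘ₗ i).codRestrict E fun c => (hE _ _).2 (by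
        change j (π (i c)) = g 0
        rw [hiπ.apply_apply_eq_zero, map_zero, map_zero]),
      (LinearMap.snd B Y₀ T₀ ∘ₗ E.subtype).codRestrict P ?_, ?_, ?_, ?_, ?_, e + 1, ?_⟩
    · rintro ⟨⟨y, t⟩, h⟩
      rw [hE] at h
      change q (g t) = 0
      rw [← h, hjq.apply_apply_eq_zero]
    · intro a b hab
      exact hi (congrArg (fun z : E => z.1.1) hab)
    · rintro ⟨⟨y, t⟩, h⟩
      constructor
      · intro h0
        have h0 : t = 0 := congrArg Subtype.val h0
        subst h0
        rw [hE, map_zero, map_eq_zero_iff j hj] at h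
        obtain ⟨c, rfl⟩ := (hiπ y).1 h
        exact ⟨c, rfl⟩
      · rintro ⟨c, hc⟩
        have : (0 : T₀) = t := congrArg (fun z : E => z.1.2) hc
        exact Subtype.ext this.symm
    · rintro ⟨t, ht⟩
      obtain ⟨c, hc⟩ := (hjq (g t)).1 ht
      obtain ⟨y, rfl⟩ := hπ c
      exact ⟨⟨(y, t), (hE _ _).2 hc⟩, rfl⟩
    · refine GenBy.ext (Y₁ := Z) (Y₂ := ModuleCat.of B E) (Y₃ := Y₀)
        (f := (LinearMap.inr B Y₀ T₀ ∘ₗ f).codRestrict E fun z => (hE _ _).2 (by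
          change j (π 0) = g (f z)
          rw [hfg.apply_apply_eq_zero, map_zero, map_zero]))
        (g := LinearMap.fst B Y₀ T₀ ∘ₗ E.subtype) ?_ ?_ ?_ hZ ((hI N).of_memAdd_of hY₀)
      · intro a b hab
        exact hf (congrArg (fun z : E => z.1.2) hab)
      · rintro ⟨⟨y, t⟩, h⟩
        constructor
        · intro h0
          have h0 : y = 0 := h0
          subst h0
          rw [hE, map_zero, map_zero] at h
          obtain ⟨z, rfl⟩ := (hfg t).1 h.symm
          exact ⟨z, rfl⟩
        · rintro ⟨z, hz⟩
          exact (congrArg (fun z : E => z.1.1) hz).symm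
      · intro y
        obtain ⟨t, ht⟩ := hg (j (π y))
        exact ⟨⟨(y, t), (hE _ _).2 ht.symm⟩, rfl⟩
    · exact CoresolvedBy.of_exact (X₁ := ModuleCat.of B P) (X₂ := T₀) (X₃ := X')
        (Submodule.subtype_injective _) (exact_ker_subtype (q ∘ₗ g)) (hq.comp hg) hT₀ he

lemma CoresolvedBy.ev {T W : ModuleCat.{u} B} {t : ℕ} (hT : ∀ i, t ≤ i → EV B (i + 1) T W) :
    ∀ {d : ℕ} {X : ModuleCat.{u} B}, CoresolvedBy T X d → ∀ i, t ≤ i → EV B (i + 1) X W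
  | 0, X, h, i, hi => EV.of_memAdd (X := X) h (hT i hi)
  | d + 1, X, ⟨T₀, hT₀, f, hf, hc⟩, i, hi =>
    EV.con₁ hf (LinearMap.exact_map_mkQ_range f) (LinearMap.range f).mkQ_surjective
      (EV.of_memAdd hT₀ (hT i hi)) (CoresolvedBy.ev hT hc (i + 1) (by omega))

lemma exists_coresolvedBy {T I : ModuleCat.{u} B} {t d : ℕ} (ht : PdLE B t T)
    (hT : ∀ i, EV B (i + 1) T T) (hI : ∀ N, GenBy T N I)
    (hB : CoresolvedBy I (ModuleCat.of B B) d) : ∃ e, CoresolvedBy T (ModuleCat.of B B) e := by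
  obtain ⟨Y, X, f, g, hf, hfg, hg, ⟨-, T₀, Z, f', g', hf', hfg', hg', hT₀, hZ⟩, e, he⟩ :=
    exists_genBy_of_coresolvedBy hI hB (t + 1)
  refine ⟨e + 1, CoresolvedBy.of_exact (X₁ := ModuleCat.of B B) (X₂ := Y) hf hfg hg ?_ he⟩
  have hY : PdLE B t Y := fun W _ _ n hn => by
    obtain ⟨n, rfl⟩ := Nat.exists_eq_succ_of_ne_zero (Nat.zero_lt_of_lt hn).ne'
    exact EV.con₂ hf hfg hg EV.of_projective (CoresolvedBy.ev (t := t) (W := ModuleCat.of B W)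
      (fun i hi => ht W (i + 1) (by omega)) he n (by omega))
  have hYT : ∀ i, EV B (i + 1) Y T := fun i =>
    EV.con₂ hf hfg hg EV.of_projective (CoresolvedBy.ev (t := 0) (fun i _ => hT i) he i i.zero_le)
  obtain ⟨s, hs⟩ := EV.exists_lift hf' hfg' hg'
    (GenBy.ev_of_le hY hYT 0 hZ (by omega)) LinearMap.id
  exact hT₀.retract s g' (LinearMap.congr_fun hs)

end DualBongartz

section KDual

/-- The `k`-linear dual of a `k`-algebra `B`, as a left `B`-module via `(b f) x = f (x b)`. -/
def KDual (k B : Type u) [Field k] [Ring B] [Algebra k B] : Type u := B →ₗ[k] k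

variable (k : Type u) [Field k] {B : Type u} [Ring B] [Algebra k B]

namespace KDual

instance : AddCommGroup (KDual k B) := inferInstanceAs (AddCommGroup (B →ₗ[k] k))

instance : Module k (KDual k B) := inferInstanceAs (Module k (B →ₗ[k] k))

instance : Module B (KDual k B) where
  smul b f := LinearMap.comp (show B →ₗ[k] k from f) (LinearMap.mulRight k b)
  one_smul f := LinearMap.ext fun x => congrArg (show B →ₗ[k] k from f) (mul_one x)
  mul_smul a b f := LinearMap.ext fun x =>
    congrArg (show B →ₗ[k] k from f) (mul_assoc x a b).symm
  smul_zero _ := rfl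
  smul_add _ _ _ := rfl
  add_smul a b f := LinearMap.ext fun x => by
    change (show B →ₗ[k] k from f) (x * (a + b)) = _
    rw [mul_add, map_add]
    rfl
  zero_smul f := LinearMap.ext fun x => by
    change (show B →ₗ[k] k from f) (x * 0) = _
    rw [mul_zero, map_zero]
    rfl

instance : IsScalarTower k B (KDual k B) := ⟨fun c b f => LinearMap.ext fun x => by
  change (show B →ₗ[k] k from f) (x * (c • b)) = c • (show B →ₗ[k] k from f) (x * b)
  rw [mul_smul_comm, map_smul]⟩

/-- The underlying functional. -/
def toFun (f : KDual k B) : B →ₗ[k] k := f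

variable {k}

@[ext] lemma ext {f g : KDual k B} (h : ∀ x, toFun k f x = toFun k g x) : f = g :=
  LinearMap.ext h

lemma smul_apply (b : B) (f : KDual k B) (x : B) : toFun k (b • f) x = toFun k f (x * b) := rfl

lemma add_apply (f g : KDual k B) (x : B) : toFun k (f + g) x = toFun k f x + toFun k g x := rfl

lemma zero_apply (x : B) : toFun k (0 : KDual k B) x = 0 := rfl

variable {X : Type u} [AddCommGroup X] [Module B X] [Module k X] [IsScalarTower k B X]

/-- The module homomorphism to the dual corresponding to a functional. -/
def lift (φ : X →ₗ[k] k) : X →ₗ[B] KDual k B where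
  toFun x := φ ∘ₗ (LinearMap.toSpanSingleton B X x).restrictScalars k
  map_add' x y := LinearMap.ext fun b => by
    change φ (b • (x + y)) = φ (b • x) + φ (b • y)
    rw [smul_add, map_add]
  map_smul' a x := LinearMap.ext fun b => by
    change φ (b • a • x) = φ ((b * a) • x)
    rw [mul_smul]

lemma lift_apply (φ : X →ₗ[k] k) (x : X) (b : B) : KDual.toFun k (lift φ x) b = φ (b • x) := rfl

end KDual

lemma isScalarTower_compHom (X : Type u) [AddCommGroup X] [Module B X] :
    letI : Module k X := Module.compHom X (algebraMap k B)
    IsScalarTower k B X :=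
  letI : Module k X := Module.compHom X (algebraMap k B)
  ⟨fun a b x => by rw [Algebra.smul_def, mul_smul]; rfl⟩

instance KDual.injective : Module.Injective B (KDual k B) := by
  refine ⟨fun X Y _ _ _ _ f hf g => ?_⟩
  let _ : Module k X := Module.compHom X (algebraMap k B)
  let _ : Module k Y := Module.compHom Y (algebraMap k B)
  have : IsScalarTower k B X := isScalarTower_compHom k X
  have : IsScalarTower k B Y := isScalarTower_compHom k Y
  let ev : KDual k B →ₗ[k] k :=
    { toFun := fun f => KDual.toFun k f 1, map_add' := fun _ _ => rfl, map_smul' := fun _ _ => rfl }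
  obtain ⟨r, hr⟩ := (f.restrictScalars k).exists_leftInverse_of_injective
    (LinearMap.ker_eq_bot.2 hf)
  refine ⟨KDual.lift (ev ∘ₗ g.restrictScalars k ∘ₗ r), fun x => KDual.ext fun b => ?_⟩
  have h : r (b • f x) = b • x := by
    rw [← map_smul]
    exact LinearMap.congr_fun hr (b • x)
  rw [KDual.lift_apply]
  change KDual.toFun k (g (r (b • f x))) 1 = _
  rw [h, map_smul, KDual.smul_apply, one_mul]

instance KDual.finite [Module.Finite k B] : Module.Finite B (KDual k B) := by
  have : Module.Finite k (KDual k B) := inferInstanceAs (Module.Finite k (B →ₗ[k] k))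
  exact Module.Finite.of_restrictScalars_finite k B _

lemma exists_embedding_kDual [Module.Finite k B] (X : Type u) [AddCommGroup X] [Module B X]
    [Module.Finite B X] :
    ∃ (n : ℕ) (f : X →ₗ[B] (Fin n → KDual k B)), Function.Injective f := by
  let _ : Module k X := Module.compHom X (algebraMap k B)
  have : IsScalarTower k B X := isScalarTower_compHom k X
  have : Module.Finite k X := Module.Finite.trans B X
  let b := Module.finBasis k X
  refine ⟨_, LinearMap.pi fun i => KDual.lift (b.coord i), ?_⟩
  rw [injective_iff_map_eq_zero]
  intro x hx
  refine b.ext_elem fun i => ?_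
  have := congrArg (fun f => KDual.toFun k f (1 : B)) (congrFun hx i)
  simp only [LinearMap.pi_apply, KDual.lift_apply, one_smul] at this
  simpa [KDual.zero_apply] using this

lemma coresolvedBy_kDual [Module.Finite k B] : ∀ (d : ℕ) (X : ModuleCat.{u} B),
    Module.Finite B X → (∀ (Y : Type u) [AddCommGroup Y] [Module B Y] [Module.Finite B Y],
      EV B (d + 1) Y X) → CoresolvedBy (ModuleCat.of B (KDual k B)) X d := by
  intro d
  induction d with
  | zero =>
    intro X _ h
    obtain ⟨n, f, hf⟩ := exists_embedding_kDual k (B := B) X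
    obtain ⟨r, hr⟩ := EV.exists_extend hf (LinearMap.exact_map_mkQ_range f)
      (LinearMap.range f).mkQ_surjective (h _) LinearMap.id
    exact ⟨n, f, r, hr⟩
  | succ d ih =>
    intro X _ h
    obtain ⟨n, f, hf⟩ := exists_embedding_kDual k (B := B) X
    refine CoresolvedBy.of_exact (X₂ := ModuleCat.of B (Fin n → KDual k B))
      (X₃ := ModuleCat.of B ((Fin n → KDual k B) ⧸ LinearMap.range f)) hf
      (LinearMap.exact_map_mkQ_range f) (LinearMap.range f).mkQ_surjective ?_ (ih _ ?_ ?_)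
    · exact memAdd_of_retract (n := n) LinearMap.id LinearMap.id fun _ => rfl
    · exact inferInstanceAs (Module.Finite B ((Fin n → KDual k B) ⧸ LinearMap.range f))
    · intro Y _ _ _
      exact EV.cov₃ hf (LinearMap.exact_map_mkQ_range f) (LinearMap.range f).mkQ_surjective
        (EV.pi' EV.of_injective) (h Y)

lemma dual_bongartz [Module.Finite k B] {M : Type u} [AddCommGroup M] [Module B M]
    [Module.Finite B M] {d : ℕ}
    (hd : ∀ (Y : Type u) [AddCommGroup Y] [Module B Y] [Module.Finite B Y], PdLE B d Y)
    (hM : ∀ n, EV B (n + 1) M M) (hI : ∀ n, EV B (n + 2) (KDual k B) M) :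
    ∃ N : ModuleCat.{u} B, Module.Finite B N ∧ IsTilting (dSum (ModuleCat.of B M) N) := by
  have : IsNoetherianRing B := IsNoetherianRing.of_finite k B
  obtain ⟨n, p, hp⟩ := Module.Finite.exists_fin' B (KDual k B)
  obtain ⟨m, h, hh⟩ := exists_hom_generators k (B := B) (X := LinearMap.ker p) (Y := M)
  let i := (LinearMap.ker p).subtype
  have hi : Function.Injective i := Submodule.subtype_injective _
  have hip : Function.Exact i p := exact_ker_subtype p
  obtain ⟨E, ι, π, ψ, hι, hιπ, hπ, -, hex, hsurj⟩ := exists_pushout hi hip hp (LinearMap.pi h)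
  have hEM : ∀ n, EV B (n + 1) E M := fun n => by
    cases n with
    | zero =>
      refine EV.one_of_extend (fun a b hab => hi (congrArg Prod.snd hab)) hex hsurj
        (EV.prod (EV.pi (hM 0)) EV.of_projective) fun φ => ?_
      obtain ⟨c, hc⟩ := hh φ
      refine ⟨-(∑ t, (scalarEnd B M (c t)) ∘ₗ LinearMap.proj t) ∘ₗ LinearMap.fst B _ _, ?_⟩
      ext y
      rw [hc]
      simp [scalarEnd_apply, -algebraMap_smul]
    | succ n => exact EV.con₂ hι hιπ hπ (EV.pi (hM _)) (hI n)
  have hEE : ∀ n, EV B (n + 1) E E := fun n =>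
    EV.cov₂ hι hιπ hπ (EV.pi' (hEM n)) EV.of_injective
  have hME : ∀ n, EV B (n + 1) M E := fun n =>
    EV.cov₂ hι hιπ hπ (EV.pi' (hM n)) EV.of_injective
  have hEfin : Module.Finite B E := finite_of_exact hιπ
  have hT : ∀ n, EV B (n + 1) (M × E) (M × E) := fun n =>
    EV.prod (EV.prod' (hM n) (hME n)) (EV.prod' (hEM n) (hEE n))
  have hTd : PdLE B d (M × E) := hd _
  refine ⟨E, hEfin, hasFiniteProjDim_iff.2 ⟨d, hTd⟩, fun n hn => ?_, ?_⟩
  · obtain ⟨n, rfl⟩ := Nat.exists_eq_succ_of_ne_zero hn.ne'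
    exact hT n
  · refine exists_coresolvedBy (T := ModuleCat.of B (M × E))
      (I := ModuleCat.of B (KDual k B)) (d := d) hTd hT (fun N => ?_)
      (coresolvedBy_kDual k d _ (inferInstanceAs (Module.Finite B B)) fun Y _ _ _ =>
        hd Y B _ d.lt_succ_self)
    cases N with
    | zero => exact fun _ => EV.of_injective
    | succ N =>
      refine ⟨fun _ => EV.of_injective, E, ModuleCat.of B (Fin m → M), ι, π, hι, hιπ, hπ, ?_,
        GenBy.of_memAdd hT ?_⟩
      · exact memAdd_of_retract (n := 1) (LinearMap.pi fun _ => LinearMap.inr B M E)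
          (LinearMap.snd B M E ∘ₗ LinearMap.proj 0) fun x => rfl
      · exact memAdd_of_retract (n := m) ((LinearMap.inl B M E).compLeft (Fin m))
          ((LinearMap.fst B M E).compLeft (Fin m)) fun x => rfl

end KDual

/-- The opposite quiver data. -/
def GentleQuiverData.op (Q : GentleQuiverData.{u}) : GentleQuiverData.{u} where
  V := Q.V
  E := Q.E
  fintV := Q.fintV
  fintE := Q.fintE
  src := Q.tgt
  tgt := Q.src
  rel a b := Q.rel b a
  rel_comp a b h := (Q.rel_comp b a h).symm
  src_le_two := Q.tgt_le_two
  tgt_le_two := Q.src_le_two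
  rel_right_unique a b c := Q.rel_left_unique a b c
  rel_left_unique a b c := Q.rel_right_unique a b c
  nonrel_right_unique a b c h₁ h₂ h₃ h₄ := Q.nonrel_left_unique a b c h₁.symm h₂ h₃.symm h₄
  nonrel_left_unique a b c h₁ h₂ h₃ h₄ := Q.nonrel_right_unique a b c h₁.symm h₂ h₃.symm h₄

/-- The relations of the opposite of a gentle algebra, so that left modules are representations
of the quiver. -/
structure QRel (Q : GentleQuiverData.{u}) {A : Type u} [Ring A] (e : Q.V → A) (x : Q.E → A) :
    Prop where
  idem : ∀ v, e v * e v = e v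
  orth : ∀ v w, v ≠ w → e v * e w = 0
  sum : ∑ v, e v = 1
  src : ∀ c, x c * e (Q.src c) = x c
  tgt : ∀ c, e (Q.tgt c) * x c = x c
  rel : ∀ c d, Q.rel c d → x d * x c = 0

/-- `B` is presented by the vertices `e`, the arrows `x` and the relations `QRel`. -/
structure IsGentle (k : Type u) [Field k] (Q : GentleQuiverData.{u}) {B : Type u} [Ring B]
    [Algebra k B] (e : Q.V → B) (x : Q.E → B) : Prop extends QRel Q e x where
  lift : ∀ (A : Type u) [Ring A] [Algebra k A] (e' : Q.V → A) (x' : Q.E → A), QRel Q e' x' →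
    ∃ φ : B →ₐ[k] A, (∀ v, φ (e v) = e' v) ∧ ∀ c, φ (x c) = x' c
  gen : ∀ S : Subalgebra k B, (∀ v, e v ∈ S) → (∀ c, x c ∈ S) → ∀ b, b ∈ S

section Presentation

open MulOpposite

lemma QRel.mulOpposite {Q : GentleQuiverData.{u}} {A : Type u} [Ring A] {e : Q.V → A} {x : Q.E → A}
    (h : QRel Q e x) : QRel Q.op (A := Aᵐᵒᵖ) (fun v => op (e v)) (fun c => op (x c)) where
  idem v := congrArg op (h.idem v)
  orth v w hvw := congrArg op (h.orth w v hvw.symm)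
  sum := by
    have := congrArg op h.sum
    rwa [Finset.op_sum] at this
  src c := congrArg op (h.tgt c)
  tgt c := congrArg op (h.src c)
  rel c d hcd := congrArg op (h.rel d c hcd)

lemma QRel.of_op {Q : GentleQuiverData.{u}} {A : Type u} [Ring A] {e : Q.V → A} {x : Q.E → A}
    (h : QRel Q.op e x) : QRel Q (A := Aᵐᵒᵖ) (fun v => op (e v)) (fun c => op (x c)) :=
  QRel.mulOpposite (Q := Q.op) h

variable {k : Type u} [Field k] {Q : GentleQuiverData.{u}} {B : Type u} [Ring B] [Algebra k B]
  {e : Q.V → B} {x : Q.E → B}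

lemma IsGentle.mulOpposite (h : IsGentle k Q e x) :
    IsGentle k Q.op (B := Bᵐᵒᵖ) (fun v => op (e v)) (fun c => op (x c)) where
  toQRel := h.toQRel.mulOpposite
  lift A _ _ e' x' h' := by
    obtain ⟨φ, h₁, h₂⟩ := h.lift Aᵐᵒᵖ _ _ h'.of_op
    exact ⟨AlgHom.opComm φ, fun v => congrArg unop (h₁ v),
      fun c => congrArg unop (h₂ c)⟩
  gen S hv hc b := h.gen S.unop hv hc b.unop

lemma gentleAlg_isGentle (k : Type u) [Field k] (Q : GentleQuiverData.{u}) :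
    IsGentle k Q (B := (GentleAlg k Q)ᵐᵒᵖ)
      (fun v => op (RingQuot.mkAlgHom k (GentleRel k Q) (FreeAlgebra.ι k (Sum.inl v))))
      (fun c => op (RingQuot.mkAlgHom k (GentleRel k Q) (FreeAlgebra.ι k (Sum.inr c)))) where
  idem v := congrArg op ((map_mul _ _ _).symm.trans
    (RingQuot.mkAlgHom_rel k (GentleRel.idem (k := k) (Q := Q) v)))
  orth v w h := congrArg op ((map_mul _ _ _).symm.trans
    ((RingQuot.mkAlgHom_rel k (GentleRel.orth (k := k) (Q := Q) w v h.symm)).trans (map_zero _)))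
  sum := by
    have := congrArg op (RingQuot.mkAlgHom_rel k (GentleRel.sum_idem (k := k) (Q := Q)))
    rwa [map_sum, map_one, Finset.op_sum] at this
  src c := congrArg op ((map_mul _ _ _).symm.trans
    (RingQuot.mkAlgHom_rel k (GentleRel.src_mul (k := k) (Q := Q) c)))
  tgt c := congrArg op ((map_mul _ _ _).symm.trans
    (RingQuot.mkAlgHom_rel k (GentleRel.mul_tgt (k := k) (Q := Q) c)))
  rel c d h := congrArg op ((map_mul _ _ _).symm.trans
    ((RingQuot.mkAlgHom_rel k (GentleRel.relation (k := k) (Q := Q) c d h)).trans (map_zero _)))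
  lift A _ _ e' x' h := by
    let ψ : FreeAlgebra k (Q.V ⊕ Q.E) →ₐ[k] Aᵐᵒᵖ :=
      FreeAlgebra.lift k (Sum.elim (fun v => op (e' v)) (fun c => op (x' c)))
    have hψ : ∀ ⦃a b⦄, GentleRel k Q a b → ψ a = ψ b := by
      intro a b hab
      cases hab with
      | idem v => simpa [ψ] using congrArg op (h.idem v)
      | orth v w hvw => simpa [ψ] using congrArg op (h.orth w v hvw.symm)
      | sum_idem => simpa [ψ, Finset.op_sum] using congrArg op h.sum
      | src_mul c => simpa [ψ] using congrArg op (h.src c)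
      | mul_tgt c => simpa [ψ] using congrArg op (h.tgt c)
      | relation c d hcd => simpa [ψ] using congrArg op (h.rel c d hcd)
    refine ⟨AlgHom.opComm (RingQuot.liftAlgHom k ⟨ψ, hψ⟩), fun v => ?_, fun c => ?_⟩
    · simp [AlgHom.opComm, ψ]
    · simp [AlgHom.opComm, ψ]
  gen S hv hc := by
    have : ∀ a, RingQuot.mkAlgHom k (GentleRel k Q) a ∈ S.unop := fun a => by
      induction a using FreeAlgebra.induction with
      | grade0 r => rw [AlgHom.commutes]; exact S.unop.algebraMap_mem r
      | grade1 y =>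
        cases y with
        | inl v => exact hv v
        | inr c => exact hc c
      | mul a b ha hb => rw [map_mul]; exact S.unop.mul_mem ha hb
      | add a b ha hb => rw [map_add]; exact S.unop.add_mem ha hb
    intro b
    obtain ⟨a, ha⟩ := RingQuot.mkAlgHom_surjective k (GentleRel k Q) b.unop
    have h2 := this a
    rw [ha] at h2
    exact h2

end Presentation

section GentleStructure

variable {k : Type u} [Field k] {Q : GentleQuiverData.{u}} {B : Type u} [Ring B] [Algebra k B]
  {e : Q.V → B} {x : Q.E → B}

namespace IsGentle

lemma induction (h : IsGentle k Q e x) {P : B → Prop} (hv : ∀ v, P (e v)) (hc : ∀ c, P (x c))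
    (halg : ∀ a : k, P (algebraMap k B a)) (hadd : ∀ a b, P a → P b → P (a + b))
    (hmul : ∀ a b, P a → P b → P (a * b)) (b : B) : P b :=
  h.gen { carrier := {b | P b}
          mul_mem' := fun ha hb => hmul _ _ ha hb
          add_mem' := fun ha hb => hadd _ _ ha hb
          algebraMap_mem' := halg } hv hc b

/-- The arrows leaving the target of `c` along a relation generate the left ideal of elements
annihilating `x c`. -/
lemma mem_span_of_sum_eq_zero (h : IsGentle k Q e x) (r : Q.E → B) (hr : ∑ c, r c * x c = 0)
    (c : Q.E) : r c * e (Q.tgt c) ∈ Submodule.span B {y | ∃ d, Q.rel c d ∧ y = x d} := by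
  classical
  let J : Q.E → Submodule B B := fun c =>
    Submodule.span B ({y | ∃ d, Q.rel c d ∧ y = x d} ∪ {1 - e (Q.tgt c)})
  let Z := ∀ c, B ⧸ J c
  let o : Q.E → Z := fun c => Pi.single c ((J c).mkQ 1)
  have ho : ∀ b c, b • o c = Pi.single c ((J c).mkQ b) := fun b c => by
    rw [← Pi.single_smul, ← map_smul, smul_eq_mul, mul_one]
  let act : B →ₐ[k] Module.End k Z := Algebra.lsmul k k Z
  let e' : Q.V → Module.End k ((Q.V → k) × Z) := fun v =>
    LinearMap.prodMap (LinearMap.single k (fun _ => k) v ∘ₗ LinearMap.proj v) (act (e v))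
  let x' : Q.E → Module.End k ((Q.V → k) × Z) := fun c =>
    LinearMap.inr k _ _ ∘ₗ (act (x c) ∘ₗ LinearMap.snd k _ _ +
      LinearMap.toSpanSingleton k Z (o c) ∘ₗ LinearMap.proj (Q.src c) ∘ₗ LinearMap.fst k _ _)
  have he : ∀ v y, e' v y = (Pi.single v (y.1 v), e v • y.2) := fun _ _ => rfl
  have hx : ∀ c y, x' c y = (0, x c • y.2 + y.1 (Q.src c) • o c) := fun _ _ => rfl
  have hrel : QRel Q e' x' := by
    constructor
    · intro v
      refine LinearMap.ext fun y => ?_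
      rw [Module.End.mul_apply, he, he]
      simp only [Pi.single_eq_same, ← mul_smul, h.idem]
    · intro v w hvw
      refine LinearMap.ext fun y => ?_
      rw [Module.End.mul_apply, he, he]
      simp only [← mul_smul, h.orth v w hvw, Pi.single_eq_of_ne hvw, Pi.single_zero]
      exact Prod.ext rfl (zero_smul B y.2)
    · refine LinearMap.ext fun y => ?_
      rw [LinearMap.sum_apply]
      refine Prod.ext ?_ ?_
      · rw [Prod.fst_sum]
        simp only [he, Module.End.one_apply]
        exact Finset.univ_sum_single y.1
      · rw [Prod.snd_sum]
        simp only [he, ← Finset.sum_smul, h.sum, one_smul, Module.End.one_apply]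
    · intro c
      refine LinearMap.ext fun y => ?_
      rw [Module.End.mul_apply, hx, hx, he]
      simp only [Pi.single_eq_same, ← mul_smul, h.src]
    · intro c
      refine LinearMap.ext fun y => ?_
      have h1 : e (Q.tgt c) • o c = o c := by
        rw [ho]
        refine congrArg (Pi.single c) ((Submodule.Quotient.eq _).2 ?_)
        rw [← neg_sub, Submodule.neg_mem_iff]
        exact Submodule.subset_span (Or.inr rfl)
      rw [Module.End.mul_apply, he, hx]
      simp only [Pi.zero_apply, Pi.single_zero, smul_add, ← mul_smul, h.tgt]
      rw [smul_comm, h1]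
    · intro c d hcd
      refine LinearMap.ext fun y => ?_
      have h1 : x d • o c = 0 := by
        have h0 : (J c).mkQ (x d) = 0 :=
          (Submodule.Quotient.mk_eq_zero _).2 (Submodule.subset_span (Or.inl ⟨d, hcd, rfl⟩))
        rw [ho, h0, Pi.single_zero]
      rw [Module.End.mul_apply, hx, hx]
      simp only [Pi.zero_apply, smul_add, ← mul_smul, h.rel c d hcd]
      rw [smul_comm, h1, smul_zero, add_zero, zero_smul B y.2, zero_smul k (o d), add_zero]
      rfl
  obtain ⟨φ, hφe, hφx⟩ := h.lift _ e' x' hrel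
  have hφ : ∀ b z, φ b (0, z) = (0, b • z) := by
    intro b
    induction b using h.induction with
    | hv v => intro z; rw [hφe, he]; simp
    | hc c =>
      intro z
      rw [hφx, hx]
      exact Prod.ext rfl ((congrArg (x c • z + ·) (zero_smul k (o c))).trans (add_zero _))
    | halg a =>
      intro z
      rw [AlgHom.commutes, Module.algebraMap_end_apply]
      exact Prod.ext (smul_zero a) (algebraMap_smul B a z).symm
    | hadd a b ha hb =>
      intro z
      rw [map_add, LinearMap.add_apply, ha, hb]
      exact Prod.ext (add_zero 0) (add_smul a b z).symm
    | hmul a b ha hb => intro z; rw [map_mul, Module.End.mul_apply, hb, ha, mul_smul]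
  have h1 : (∑ c, r c • o c) = 0 := by
    have := congrArg (fun b => (φ b ((fun _ => 1), 0)).2) hr
    simpa only [map_sum, map_mul, LinearMap.sum_apply, Module.End.mul_apply, hφx, hx, hφ,
      smul_zero, zero_add, one_smul, Prod.snd_sum, map_zero, LinearMap.zero_apply,
      Prod.snd_zero] using this
  have h2 := congrFun h1 c
  simp only [ho] at h2
  rw [Finset.univ_sum_single (fun c => (J c).mkQ (r c))] at h2
  have h3 : r c ∈ J c := (Submodule.Quotient.mk_eq_zero _).1 h2
  clear h1 h2
  generalize r c = s at h3
  induction h3 using Submodule.span_induction with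
  | mem y hy =>
    rcases hy with ⟨d, hd, rfl⟩ | hy
    · rw [Q.rel_comp c d hd, h.src]
      exact Submodule.subset_span ⟨d, hd, rfl⟩
    · rw [Set.mem_singleton_iff.1 hy, sub_mul, one_mul, h.idem, sub_self]
      exact Submodule.zero_mem _
  | zero => rw [zero_mul]; exact Submodule.zero_mem _
  | add a b _ _ ha hb => rw [add_mul]; exact Submodule.add_mem _ ha hb
  | smul a b _ hb => rw [smul_eq_mul, mul_assoc]; exact Submodule.smul_mem _ a hb

lemma mem_span_of_mul_eq_zero (h : IsGentle k Q e x) {r : B} {c : Q.E} (hr : r * x c = 0) :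
    r * e (Q.tgt c) ∈ Submodule.span B {y | ∃ d, Q.rel c d ∧ y = x d} := by
  classical
  have := h.mem_span_of_sum_eq_zero (Pi.single c r) (by
    rw [Finset.sum_eq_single c (fun d _ hd => by rw [Pi.single_eq_of_ne hd, zero_mul])
      (fun hc => absurd (Finset.mem_univ c) hc), Pi.single_eq_same, hr]) c
  rwa [Pi.single_eq_same] at this

/-- Right-hand version of `mem_span_of_mul_eq_zero`: an element annihilated by `x d` is
a right multiple of the arrow preceding `d` along a relation. -/
lemma exists_eq_mul_of_mul_eq_zero (h : IsGentle k Q e x) {r : B} {d : Q.E} (hr : x d * r = 0)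
    (hd : ∃ c, Q.rel c d) : ∃ c, Q.rel c d ∧ ∃ b, e (Q.src d) * r = x c * b := by
  have h1 := h.mulOpposite.mem_span_of_mul_eq_zero (r := MulOpposite.op r) (c := d)
    (congrArg MulOpposite.op hr)
  obtain ⟨c, hc⟩ := hd
  have h2 : {y | ∃ d', Q.op.rel d d' ∧ y = MulOpposite.op (x d')} ⊆ {MulOpposite.op (x c)} := by
    rintro _ ⟨d', hd', rfl⟩
    rw [Q.rel_left_unique d d' c hd' hc]
    rfl
  obtain ⟨b, hb⟩ := Submodule.mem_span_singleton.1 (Submodule.span_mono h2 h1)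
  exact ⟨c, hc, b.unop, (congrArg MulOpposite.unop hb).symm⟩

end IsGentle

end GentleStructure

section GentleRadical

variable {k : Type u} [Field k] {Q : GentleQuiverData.{u}} {B : Type u} [Ring B] [Algebra k B]
  {e : Q.V → B} {x : Q.E → B}

namespace IsGentle

lemma exists_length_bound (h : IsGentle k Q e x) [Module.Finite k B] :
    ∃ N, ∀ l : List Q.E, N ≤ l.length → (l.map x).prod = 0 := by
  have hrel : QRel Q (fun v => Polynomial.C (e v)) (fun c => Polynomial.C (x c) * Polynomial.X) := by
    have hX : ∀ b : B, Polynomial.X * Polynomial.C b = Polynomial.C b * Polynomial.X :=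
      Polynomial.X_mul_C
    constructor
    · intro v; rw [← map_mul, h.idem]
    · intro v w hvw; rw [← map_mul, h.orth v w hvw, map_zero]
    · rw [← map_sum, h.sum, map_one]
    · intro c; rw [mul_assoc, hX, ← mul_assoc, ← map_mul, h.src]
    · intro c; rw [← mul_assoc, ← map_mul, h.tgt]
    · intro c d hcd
      rw [mul_assoc, ← mul_assoc Polynomial.X, hX, mul_assoc, ← mul_assoc, ← map_mul,
        h.rel c d hcd, map_zero, zero_mul]
  obtain ⟨φ, -, hφ⟩ := h.lift _ _ _ hrel
  have hφl : ∀ l : List Q.E, φ (l.map x).prod = Polynomial.monomial l.length (l.map x).prod := by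
    intro l
    induction l with
    | nil => simp
    | cons c l ih =>
      rw [List.map_cons, List.prod_cons, map_mul, hφ, ih, List.length_cons,
        mul_assoc, Polynomial.X_mul_monomial, Polynomial.C_mul_monomial]
  refine ⟨Module.finrank k B, fun l hl => by_contra fun hne => ?_⟩
  have hsuf : ∀ i, ((l.drop i).map x).prod ≠ 0 := fun i hi => hne (by
    rw [← List.take_append_drop i l, List.map_append, List.prod_append, hi, mul_zero])
  have hli : LinearIndependent k (fun i : Fin (l.length + 1) => ((l.drop i).map x).prod) := by
    rw [Fintype.linearIndependent_iff]
    intro a ha j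
    have h1 := congrArg (fun b => (φ b).coeff (l.length - j)) ha
    simp only [map_sum, map_smul, hφl, Polynomial.finsetSum_coeff, Polynomial.coeff_smul,
      Polynomial.coeff_monomial, List.length_drop, map_zero, Polynomial.coeff_zero] at h1
    rw [Finset.sum_eq_single j (fun i _ hij => by
      rw [if_neg (fun hh => hij (Fin.ext (by have := i.2; have := j.2; omega))), smul_zero])
      (fun hj => absurd (Finset.mem_univ j) hj), if_pos rfl] at h1
    exact (smul_eq_zero.1 h1).resolve_right (hsuf j)
  have := hli.fintype_card_le_finrank
  rw [Fintype.card_fin] at this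
  omega

/-- Every nonzero module has a nonzero element spanning a simple submodule. -/
lemma exists_socle (h : IsGentle k Q e x) [Module.Finite k B] (X : Type u) [AddCommGroup X]
    [Module B X] [Nontrivial X] :
    ∃ z : X, z ≠ 0 ∧ ∃ v, e v • z = z ∧ ∀ c, x c • z = 0 := by
  by_contra hcon
  push Not at hcon
  obtain ⟨N, hN⟩ := h.exists_length_bound
  have : ∀ n, ∃ l : List Q.E, l.length = n ∧ ∃ (z : X) (v : Q.V), (l.map x).prod • z ≠ 0 ∧
      e v • (l.map x).prod • z = (l.map x).prod • z := by
    intro n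
    induction n with
    | zero =>
      obtain ⟨z, hz⟩ := exists_ne (0 : X)
      have : ∃ v, e v • z ≠ 0 := by
        by_contra h0
        push Not at h0
        apply hz
        rw [← one_smul B z, ← h.sum, Finset.sum_smul, Finset.sum_eq_zero fun v _ => h0 v]
      obtain ⟨v, hv⟩ := this
      refine ⟨[], rfl, e v • z, v, ?_, ?_⟩
      · simpa using hv
      · rw [List.map_nil, List.prod_nil, one_smul, ← mul_smul, h.idem]
    | succ n ih =>
      obtain ⟨l, hl, z, v, hz, hv⟩ := ih
      obtain ⟨c, hc⟩ := hcon _ hz v hv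
      refine ⟨c :: l, by rw [List.length_cons, hl], z, Q.tgt c, ?_, ?_⟩
      · rwa [List.map_cons, List.prod_cons, mul_smul]
      · rw [List.map_cons, List.prod_cons, mul_smul, ← mul_smul (e _), h.tgt]
  obtain ⟨l, hl, z, -, hz, -⟩ := this N
  exact hz (by rw [hN l hl.ge, zero_smul])

lemma mul_e (h : IsGentle k Q e x) {c : Q.E} {v : Q.V} (hv : Q.src c ≠ v) : x c * e v = 0 := by
  rw [← h.src c, mul_assoc, h.orth _ _ hv, mul_zero]

lemma e_mul (h : IsGentle k Q e x) {c : Q.E} {v : Q.V} (hv : Q.tgt c ≠ v) : e v * x c = 0 := by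
  rw [← h.tgt c, ← mul_assoc, h.orth _ _ hv.symm, zero_mul]

lemma mul_eq_zero_of_ne (h : IsGentle k Q e x) {c d : Q.E} (hcd : Q.tgt c ≠ Q.src d) :
    x d * x c = 0 := by
  rw [← h.tgt c, ← mul_assoc, h.mul_e hcd.symm, zero_mul]

/-- The characters of `B` given by the vertices. -/
lemma exists_char (h : IsGentle k Q e x) : ∃ χ : B →ₐ[k] (Q.V → k),
    (∀ v, χ (e v) v = 1) ∧ ∀ c, χ (x c) = 0 := by
  classical
  obtain ⟨χ, h₁, h₂⟩ := h.lift (Q.V → k) (fun v => Pi.single v 1) 0 (by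
    constructor
    · intro v; rw [← Pi.single_mul, one_mul]
    · intro v w hvw
      ext i
      rw [Pi.mul_apply, Pi.zero_apply]
      by_cases hi : i = v
      · rw [hi, Pi.single_eq_of_ne hvw, mul_zero]
      · rw [Pi.single_eq_of_ne hi, zero_mul]
    · exact Finset.univ_sum_single (fun _ : Q.V => (1 : k))
    · intro c; exact zero_mul _
    · intro c; exact mul_zero _
    · intro c d _; exact mul_zero _)
  exact ⟨χ, fun v => by rw [h₁, Pi.single_eq_same], h₂⟩

lemma exists_decomp (h : IsGentle k Q e x) (b : B) : ∃ (a : Q.V → k) (r : Q.E → B),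
    b = ∑ v, a v • e v + ∑ c, r c * x c := by
  classical
  induction b using h.induction with
  | hv v =>
    refine ⟨Pi.single v 1, 0, ?_⟩
    rw [Finset.sum_eq_single v (fun w _ hw => by rw [Pi.single_eq_of_ne hw, zero_smul])
      (fun hv => absurd (Finset.mem_univ v) hv), Pi.single_eq_same, one_smul]
    simp
  | hc c =>
    refine ⟨0, Pi.single c 1, ?_⟩
    rw [Finset.sum_eq_single (f := fun d => Pi.single (M := fun _ => B) c 1 d * x d) c
      (fun w _ hw => by rw [Pi.single_eq_of_ne hw, zero_mul])
      (fun hv => absurd (Finset.mem_univ c) hv), Pi.single_eq_same, one_mul]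
    simp
  | halg a =>
    refine ⟨fun _ => a, 0, ?_⟩
    rw [← Finset.smul_sum, h.sum, Algebra.algebraMap_eq_smul_one]
    simp
  | hadd a b ha hb =>
    obtain ⟨a₁, r₁, h₁⟩ := ha
    obtain ⟨a₂, r₂, h₂⟩ := hb
    refine ⟨a₁ + a₂, r₁ + r₂, ?_⟩
    simp only [Pi.add_apply, add_smul, add_mul, Finset.sum_add_distrib]
    nth_rewrite 1 [h₁, h₂]
    abel
  | hmul a b ha hb =>
    obtain ⟨a₁, r₁, h₁⟩ := ha
    obtain ⟨a₂, r₂, h₂⟩ := hb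
    refine ⟨a₁ * a₂, fun c => a * r₂ c + a₂ (Q.src c) • r₁ c, ?_⟩
    have h3 : a * b = ∑ v, a₂ v • (a * e v) + ∑ c, a * r₂ c * x c := by
      nth_rewrite 1 [h₂]
      simp only [mul_add, Finset.mul_sum, mul_smul_comm, mul_assoc]
    have h4 : ∀ v, a * e v = a₁ v • e v + ∑ c, r₁ c * (x c * e v) := by
      intro v
      nth_rewrite 1 [h₁]
      rw [add_mul, Finset.sum_mul, Finset.sum_mul, Finset.sum_eq_single v
        (fun w _ hw => by rw [smul_mul_assoc, h.orth w v hw, smul_zero])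
        (fun hv => absurd (Finset.mem_univ v) hv), smul_mul_assoc, h.idem]
      simp only [mul_assoc]
    rw [h3]
    simp only [h4, smul_add, Finset.smul_sum, Finset.sum_add_distrib, Pi.mul_apply, add_mul,
      smul_smul]
    rw [Finset.sum_comm, add_assoc]
    congr 1
    · exact Finset.sum_congr rfl fun v _ => by rw [mul_comm]
    · rw [add_comm]
      congr 1
      refine Finset.sum_congr rfl fun c _ => ?_
      rw [Finset.sum_eq_single (Q.src c) (fun w _ hw => by rw [h.mul_e hw.symm, mul_zero, smul_zero])
        (fun hv => absurd (Finset.mem_univ _) hv), h.src, smul_mul_assoc]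

lemma exists_decomp' (h : IsGentle k Q e x) (b : B) : ∃ (a : Q.V → k) (r : Q.E → B),
    b = ∑ v, a v • e v + ∑ c, x c * r c := by
  obtain ⟨a, r, hr⟩ := h.mulOpposite.exists_decomp (MulOpposite.op b)
  refine ⟨a, fun c => (r c).unop, ?_⟩
  have := congrArg MulOpposite.unop hr
  rw [MulOpposite.unop_op, MulOpposite.unop_add, Finset.unop_sum, Finset.unop_sum] at this
  exact this

lemma linear_of_commutes (h : IsGentle k Q e x) {X Y : Type u} [AddCommGroup X] [Module B X]
    [Module k X] [IsScalarTower k B X] [AddCommGroup Y] [Module B Y] [Module k Y]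
    [IsScalarTower k B Y] (φ : X →ₗ[k] Y) (hv : ∀ v y, φ (e v • y) = e v • φ y)
    (hc : ∀ c y, φ (x c • y) = x c • φ y) : ∃ ψ : X →ₗ[B] Y, ∀ y, ψ y = φ y := by
  refine ⟨{ toFun := φ, map_add' := φ.map_add, map_smul' := fun b => ?_ }, fun _ => rfl⟩
  induction b using h.induction with
  | hv v => exact hv v
  | hc c => exact hc c
  | halg a => intro y; rw [algebraMap_smul, map_smul, RingHom.id_apply, algebraMap_smul]
  | hadd a b ha hb => intro y; rw [add_smul, map_add, ha, hb]; exact (add_smul a b (φ y)).symm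
  | hmul a b ha hb => intro y; rw [mul_smul, ha, hb]; exact (mul_smul a b (φ y)).symm

lemma exists_list_of_cycle (h : IsGentle k Q e x) (S : Set Q.E) (hS : S.Nonempty)
    (hcyc : ∀ s ∈ S, ∃ t ∈ S, Q.tgt t = Q.src s ∧ ¬ Q.rel t s) (n : ℕ) :
    ∃ l : List Q.E, l.length = n + 1 ∧ ∃ s ∈ S, (l.map x).prod * e (Q.src s) = (l.map x).prod ∧
      (l.map x).prod ∉ Submodule.span B {y | ∃ d, d ≠ s ∧ y = x d} := by
  classical
  have key : ∀ (b : B) (s : Q.E), b * x s ∈ Submodule.span B {y | ∃ d, d ≠ s ∧ y = x d} →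
      b * e (Q.tgt s) ∈ Submodule.span B {y | ∃ d, Q.rel s d ∧ y = x d} := by
    intro b s hb
    have : ∀ y ∈ Submodule.span B {y | ∃ d, d ≠ s ∧ y = x d}, ∃ r : Q.E → B, r s = 0 ∧
        y = ∑ c, r c * x c := by
      intro y hy
      induction hy using Submodule.span_induction with
      | mem y hy =>
        obtain ⟨d, hd, rfl⟩ := hy
        refine ⟨Pi.single d 1, Pi.single_eq_of_ne hd.symm _, ?_⟩
        rw [Finset.sum_eq_single d (fun w _ hw => by rw [Pi.single_eq_of_ne hw, zero_mul])
          (fun hv => absurd (Finset.mem_univ d) hv), Pi.single_eq_same, one_mul]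
      | zero => exact ⟨0, rfl, by simp⟩
      | add y z _ _ hy hz =>
        obtain ⟨r₁, h₁, rfl⟩ := hy
        obtain ⟨r₂, h₂, rfl⟩ := hz
        exact ⟨r₁ + r₂, by rw [Pi.add_apply, h₁, h₂, add_zero], by
          simp only [Pi.add_apply, add_mul, Finset.sum_add_distrib]⟩
      | smul a y _ hy =>
        obtain ⟨r₁, h₁, rfl⟩ := hy
        exact ⟨a • r₁, by rw [Pi.smul_apply, h₁, smul_zero], by
          simp only [Pi.smul_apply, smul_eq_mul, Finset.mul_sum, mul_assoc]⟩
    obtain ⟨r, hrs, hr⟩ := this _ hb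
    have h1 := h.mem_span_of_sum_eq_zero (Pi.single s b - r) (by
      simp only [Pi.sub_apply, sub_mul, Finset.sum_sub_distrib, ← hr]
      rw [Finset.sum_eq_single s (fun w _ hw => by rw [Pi.single_eq_of_ne hw, zero_mul])
        (fun hv => absurd (Finset.mem_univ s) hv), Pi.single_eq_same, sub_self]) s
    rwa [Pi.sub_apply, hrs, sub_zero, Pi.single_eq_same] at h1
  induction n with
  | zero =>
    obtain ⟨s, hs⟩ := hS
    refine ⟨[s], rfl, s, hs, by simpa using h.src s, fun hmem => ?_⟩
    obtain ⟨χ, h₁, h₂⟩ := h.exists_char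
    have h3 := key 1 s (by simpa using hmem)
    have h4 : ∀ y ∈ Submodule.span B {y | ∃ d, Q.rel s d ∧ y = x d}, χ y = 0 := by
      intro y hy
      induction hy using Submodule.span_induction with
      | mem y hy => obtain ⟨d, -, rfl⟩ := hy; exact h₂ d
      | zero => exact map_zero _
      | add y z _ _ hy hz => rw [map_add, hy, hz, add_zero]
      | smul a y _ hy => rw [smul_eq_mul, map_mul, hy, mul_zero]
    have h5 := congrFun (h4 _ h3) (Q.tgt s)
    rw [one_mul, h₁] at h5
    exact one_ne_zero h5
  | succ n ih =>
    obtain ⟨l, hl, s, hs, hls, hmem⟩ := ih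
    obtain ⟨t, ht, hts, hrel⟩ := hcyc s hs
    refine ⟨l ++ [t], by rw [List.length_append, hl]; rfl, t, ht, ?_, fun hmem' => hmem ?_⟩
    · simp [mul_assoc, h.src]
    · have h1 := key (l.map x).prod t (by simpa using hmem')
      rw [hts, hls] at h1
      refine Submodule.span_mono ?_ h1
      rintro _ ⟨d, hd, rfl⟩
      exact ⟨d, fun hds => hrel (hds ▸ hd), rfl⟩

/-- Finite-dimensionality excludes oriented cycles without relations. -/
lemma no_cycle (h : IsGentle k Q e x) [Module.Finite k B] (S : Set Q.E) (hS : S.Nonempty)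
    (hcyc : ∀ s ∈ S, ∃ t ∈ S, Q.tgt t = Q.src s ∧ ¬ Q.rel t s) : False := by
  obtain ⟨N, hN⟩ := h.exists_length_bound
  obtain ⟨l, hl, s, -, -, hmem⟩ := h.exists_list_of_cycle S hS hcyc N
  rw [hN l (by omega)] at hmem
  exact hmem (Submodule.zero_mem _)

end IsGentle

end GentleRadical

section VertexSimple

variable {k : Type u} [Field k] {Q : GentleQuiverData.{u}} {B : Type u} [Ring B] [Algebra k B]
  {e : Q.V → B} {x : Q.E → B}

/-- The simple module at the vertex `v`. -/
abbrev VSimple (e : Q.V → B) (x : Q.E → B) (v : Q.V) : Type u :=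
  B ⧸ Submodule.span B (Set.range x ∪ {1 - e v})

/-- The generator of the simple module at `v`. -/
def VSimple.gen (e : Q.V → B) (x : Q.E → B) (v : Q.V) : VSimple e x v := Submodule.Quotient.mk 1

lemma VSimple.x_smul_gen (v : Q.V) (c : Q.E) : x c • VSimple.gen e x v = 0 :=
  (Submodule.Quotient.mk_eq_zero _).2 (by
    change x c * 1 ∈ _
    rw [mul_one]
    exact Submodule.subset_span (Or.inl ⟨c, rfl⟩))

lemma VSimple.e_smul_gen (v : Q.V) : e v • VSimple.gen e x v = VSimple.gen e x v :=
  (Submodule.Quotient.eq _).2 (by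
    change e v * 1 - 1 ∈ _
    rw [mul_one, ← Submodule.neg_mem_iff, neg_sub]
    exact Submodule.subset_span (Or.inr rfl))

namespace IsGentle

lemma e_smul_gen_of_ne (h : IsGentle k Q e x) {v w : Q.V} (hvw : w ≠ v) :
    e w • VSimple.gen e x v = 0 := by
  rw [← VSimple.e_smul_gen, ← mul_smul, h.orth w v hvw, zero_smul]

lemma exists_smul_gen (h : IsGentle k Q e x) {v : Q.V} (s : VSimple e x v) :
    ∃ a : k, s = a • VSimple.gen e x v := by
  classical
  obtain ⟨b, rfl⟩ := Submodule.Quotient.mk_surjective _ s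
  have hb : (Submodule.Quotient.mk b : VSimple e x v) = b • VSimple.gen e x v := by
    rw [VSimple.gen, ← Submodule.Quotient.mk_smul, smul_eq_mul, mul_one]
  rw [hb]
  clear hb
  induction b using h.induction with
  | hv w =>
    by_cases hw : w = v
    · exact ⟨1, by rw [hw, VSimple.e_smul_gen, one_smul]⟩
    · exact ⟨0, by rw [h.e_smul_gen_of_ne hw, zero_smul]⟩
  | hc c => exact ⟨0, by rw [VSimple.x_smul_gen, zero_smul]⟩
  | halg a => exact ⟨a, algebraMap_smul B a _⟩
  | hadd b c hb hc =>
    obtain ⟨a₁, h₁⟩ := hb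
    obtain ⟨a₂, h₂⟩ := hc
    exact ⟨a₁ + a₂, by rw [add_smul, h₁, h₂, add_smul]⟩
  | hmul b c hb hc =>
    obtain ⟨a₁, h₁⟩ := hb
    obtain ⟨a₂, h₂⟩ := hc
    exact ⟨a₂ * a₁, by rw [mul_smul, h₂, smul_comm, h₁, mul_smul]⟩

lemma gen_ne_zero (h : IsGentle k Q e x) (v : Q.V) : VSimple.gen e x v ≠ 0 := by
  intro h0
  obtain ⟨χ, h₁, h₂⟩ := h.exists_char
  have : ∀ y ∈ Submodule.span B (Set.range x ∪ {1 - e v}), χ y v = 0 := by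
    intro y hy
    induction hy using Submodule.span_induction with
    | mem y hy =>
      rcases hy with ⟨c, rfl⟩ | rfl
      · rw [h₂, Pi.zero_apply]
      · rw [map_sub, map_one, Pi.sub_apply, h₁, Pi.one_apply, sub_self]
    | zero => rw [map_zero, Pi.zero_apply]
    | add y z _ _ hy hz => rw [map_add, Pi.add_apply, hy, hz, add_zero]
    | smul a y _ hy => rw [smul_eq_mul, map_mul, Pi.mul_apply, hy, mul_zero]
  have h3 := this 1 ((Submodule.Quotient.mk_eq_zero _).1 h0)
  rw [map_one, Pi.one_apply] at h3
  exact one_ne_zero h3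

lemma smul_gen_eq_zero (h : IsGentle k Q e x) {v : Q.V} {a : k}
    (ha : a • VSimple.gen e x v = 0) : a = 0 :=
  (smul_eq_zero.1 ha).resolve_right (h.gen_ne_zero v)

lemma exists_vSimple_hom {X : Type u} [AddCommGroup X] [Module B X] {v : Q.V} {z : X}
    (hv : e v • z = z) (hc : ∀ c, x c • z = 0) :
    ∃ φ : VSimple e x v →ₗ[B] X, φ (VSimple.gen e x v) = z := by
  refine ⟨Submodule.liftQ _ (LinearMap.toSpanSingleton B X z) (Submodule.span_le.2 ?_), ?_⟩
  · rintro y (⟨c, rfl⟩ | rfl)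
    · exact hc c
    · change (1 - e v) • z = 0
      rw [sub_smul, one_smul, hv, sub_self]
  · exact (Submodule.liftQ_apply _ _ _).trans (one_smul B z)

lemma injective_of_gen_ne_zero (h : IsGentle k Q e x) {X : Type u} [AddCommGroup X] [Module B X]
    {v : Q.V} {φ : VSimple e x v →ₗ[B] X} (hφ : φ (VSimple.gen e x v) ≠ 0) :
    Function.Injective φ := by
  let _ : Module k X := Module.compHom X (algebraMap k B)
  have : IsScalarTower k B X := isScalarTower_compHom k X
  rw [injective_iff_map_eq_zero]
  intro s hs
  obtain ⟨a, rfl⟩ := h.exists_smul_gen s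
  rw [φ.map_smul_of_tower] at hs
  rw [(smul_eq_zero.1 hs).resolve_right hφ, zero_smul]

lemma exists_hom_vSimple (h : IsGentle k Q e x) {X : Type u} [AddCommGroup X] [Module B X]
    [Module k X] [IsScalarTower k B X] {v : Q.V} (φ : X →ₗ[k] k) (hc : ∀ c y, φ (x c • y) = 0)
    (hw : ∀ w, w ≠ v → ∀ y, φ (e w • y) = 0) :
    ∃ ψ : X →ₗ[B] VSimple e x v, ∀ y, ψ y = φ y • VSimple.gen e x v := by
  have hv : ∀ y, φ (e v • y) = φ y := fun y => by
    conv_rhs => rw [← one_smul B y, ← h.sum, Finset.sum_smul, map_sum]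
    exact (Finset.sum_eq_single v (fun w _ hwv => hw w hwv y)
      (fun hv => absurd (Finset.mem_univ v) hv)).symm
  obtain ⟨ψ, hψ⟩ := h.linear_of_commutes
    (LinearMap.toSpanSingleton k (VSimple e x v) (VSimple.gen e x v) ∘ₗ φ) (fun w y => by
      change φ (e w • y) • VSimple.gen e x v = e w • φ y • VSimple.gen e x v
      rw [smul_comm]
      by_cases hwv : w = v
      · rw [hwv, hv, VSimple.e_smul_gen]
      · rw [hw w hwv, h.e_smul_gen_of_ne hwv, zero_smul, smul_zero]) (fun c y => by
      change φ (x c • y) • VSimple.gen e x v = x c • φ y • VSimple.gen e x v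
      rw [hc, smul_comm, VSimple.x_smul_gen, smul_zero, zero_smul])
  exact ⟨ψ, hψ⟩

/-- Finite-dimensional modules are built from the vertex simples by extensions. -/
lemma fd_induction (h : IsGentle k Q e x) [Module.Finite k B]
    (P : ∀ (X : Type u) [AddCommGroup X] [Module B X], Prop)
    (h0 : ∀ (X : Type u) [AddCommGroup X] [Module B X] [Subsingleton X], P X)
    (hext : ∀ (X Y : Type u) [AddCommGroup X] [Module B X] [AddCommGroup Y] [Module B Y] (v : Q.V)
      (f : VSimple e x v →ₗ[B] X) (g : X →ₗ[B] Y), Function.Injective f → Function.Exact f g →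
      Function.Surjective g → P Y → P X)
    (X : Type u) [AddCommGroup X] [Module B X] [Module.Finite B X] : P X := by
  let _ : Module k X := Module.compHom X (algebraMap k B)
  have : IsScalarTower k B X := isScalarTower_compHom k X
  have : Module.Finite k X := Module.Finite.trans B X
  obtain ⟨n, hn⟩ : ∃ n, Module.finrank k X = n := ⟨_, rfl⟩
  induction n using Nat.strong_induction_on generalizing X with
  | _ n ih =>
    rcases subsingleton_or_nontrivial X with hX | hX
    · exact h0 X
    · obtain ⟨z, hz, v, hv, hc⟩ := h.exists_socle X
      obtain ⟨φ, hφ⟩ := exists_vSimple_hom hv hc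
      refine hext X (X ⧸ LinearMap.range φ) v φ (LinearMap.range φ).mkQ
        (h.injective_of_gen_ne_zero (hφ ▸ hz)) (LinearMap.exact_map_mkQ_range φ)
        (Submodule.mkQ_surjective _) ?_
      have hpos : 0 < Module.finrank k ((LinearMap.range φ).restrictScalars k) :=
        Module.finrank_pos_iff_exists_ne_zero.2
          ⟨⟨z, ⟨_, hφ⟩⟩, fun h => hz (congrArg Subtype.val h)⟩
      have hsum := Submodule.finrank_quotient_add_finrank ((LinearMap.range φ).restrictScalars k)
      refine ih _ ?_ (X ⧸ LinearMap.range φ) ?_ ?_ rfl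
      · change Module.finrank k (X ⧸ (LinearMap.range φ).restrictScalars k) < n
        omega
      · infer_instance
      · infer_instance

lemma ev_of_vSimple (h : IsGentle k Q e x) [Module.Finite k B] {W : Type u} [AddCommGroup W]
    [Module B W] {n : ℕ} (hS : ∀ v, EV B (n + 1) (VSimple e x v) W) (X : Type u) [AddCommGroup X]
    [Module B X] [Module.Finite B X] : EV B (n + 1) X W :=
  h.fd_induction (fun X _ _ => EV B (n + 1) X W) (fun _ => EV.of_subsingleton)
    (fun _ _ _ _ _ _ v _ _ hf hfg hg hY => EV.con₂ hf hfg hg (hS v) hY) X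

lemma ev_of_vSimple' (h : IsGentle k Q e x) [Module.Finite k B] {W : Type u} [AddCommGroup W]
    [Module B W] {n : ℕ} (hS : ∀ v, EV B n W (VSimple e x v)) (X : Type u) [AddCommGroup X]
    [Module B X] [Module.Finite B X] : EV B n W X :=
  h.fd_induction (fun X _ _ => EV B n W X) (fun _ => EV.of_subsingleton')
    (fun _ _ _ _ _ _ v _ _ hf hfg hg hY => EV.cov₂ hf hfg hg (hS v) hY) X

end IsGentle

end VertexSimple

section ArrowModules

open Submodule

variable {k : Type u} [Field k] {Q : GentleQuiverData.{u}} {B : Type u} [Ring B] [Algebra k B]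
  {e : Q.V → B} {x : Q.E → B}

namespace IsGentle

lemma mul_eq_self_of_mem_span {a y : B} (ha : a * a = a) (hy : y ∈ span B {a}) : y * a = y := by
  obtain ⟨r, rfl⟩ := mem_span_singleton.1 hy
  rw [smul_eq_mul, mul_assoc, ha]

lemma projective_span {a : B} (ha : a * a = a) : Module.Projective B (span B {a}) :=
  Module.Projective.of_split (span B {a}).subtype
    ((LinearMap.toSpanSingleton B B a).codRestrict (span B {a})
      fun r => smul_mem _ r (mem_span_singleton_self a))
    (LinearMap.ext fun y => Subtype.ext (mul_eq_self_of_mem_span ha y.2))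

/-- The projective cover of the left ideal generated by an arrow. -/
lemma exists_cover (h : IsGentle k Q e x) (g : Q.E) :
    ∃ p : span B {e (Q.tgt g)} →ₗ[B] span B {x g}, Function.Surjective p ∧
      ∀ y, (p y : B) = y * x g := by
  refine ⟨((LinearMap.toSpanSingleton B B (x g)).codRestrict (span B {x g})
      fun r => smul_mem _ r (mem_span_singleton_self _)) ∘ₗ (span B {e (Q.tgt g)}).subtype,
      fun y => ?_, fun y => rfl⟩
  obtain ⟨r, hr⟩ := mem_span_singleton.1 y.2
  refine ⟨⟨r * e (Q.tgt g), smul_mem _ r (mem_span_singleton_self _)⟩, Subtype.ext ?_⟩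
  rw [← hr]
  change r * e (Q.tgt g) * x g = r * x g
  rw [mul_assoc, h.tgt]

lemma projective_arrow (h : IsGentle k Q e x) {g : Q.E} (hg : ∀ c, ¬ Q.rel g c) :
    Module.Projective B (span B {x g}) := by
  obtain ⟨p, hp, hpx⟩ := h.exists_cover g
  have hinj : Function.Injective p := by
    rw [injective_iff_map_eq_zero]
    intro y hy
    have h1 := h.mem_span_of_mul_eq_zero ((hpx y).symm.trans (congrArg Subtype.val hy))
    have h2 : {y | ∃ d, Q.rel g d ∧ y = x d} = ∅ := by
      ext y
      simp only [Set.mem_ofPred_eq, Set.mem_empty_iff_false, iff_false]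
      rintro ⟨d, hd, -⟩
      exact hg d hd
    rw [h2, span_empty, mem_bot, mul_eq_self_of_mem_span (h.idem _) y.2] at h1
    exact Subtype.ext h1
  have := projective_span (h.idem (Q.tgt g))
  exact Module.Projective.of_equiv (LinearEquiv.ofBijective p ⟨hinj, hp⟩)

/-- The syzygy of an arrow `g` is generated by the arrow following it along a relation. -/
lemma exists_syzygy (h : IsGentle k Q e x) {g c : Q.E} (hgc : Q.rel g c) :
    ∃ (i : span B {x c} →ₗ[B] span B {e (Q.tgt g)}) (p : span B {e (Q.tgt g)} →ₗ[B] span B {x g}),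
      Function.Injective i ∧ Function.Exact i p ∧ Function.Surjective p ∧
      ∀ y, (i y : B) = y := by
  obtain ⟨p, hp, hpx⟩ := h.exists_cover g
  have hle : span B {x c} ≤ span B {e (Q.tgt g)} := by
    rw [span_le, Set.singleton_subset_iff, SetLike.mem_coe, mem_span_singleton]
    exact ⟨x c, by rw [Q.rel_comp g c hgc, smul_eq_mul, h.src]⟩
  refine ⟨inclusion hle, p, inclusion_injective hle, fun y => ⟨fun hy => ?_, ?_⟩, hp, fun _ => rfl⟩
  · have h1 := h.mem_span_of_mul_eq_zero ((hpx y).symm.trans (congrArg Subtype.val hy))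
    rw [mul_eq_self_of_mem_span (h.idem _) y.2] at h1
    refine ⟨⟨y, span_mono ?_ h1⟩, rfl⟩
    rintro _ ⟨d, hd, rfl⟩
    rw [Q.rel_right_unique g d c hd hgc]
    rfl
  · rintro ⟨y, rfl⟩
    refine Subtype.ext ?_
    rw [hpx]
    obtain ⟨r, hr⟩ := mem_span_singleton.1 y.2
    change (y : B) * x g = 0
    rw [← hr, smul_eq_mul, mul_assoc, h.rel g c hgc, mul_zero]

variable {W : Type u} [AddCommGroup W] [Module B W]

lemma ev_arrow_of_not_rel (h : IsGentle k Q e x) {g : Q.E} (hg : ∀ c, ¬ Q.rel g c) (n : ℕ) :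
    EV B (n + 1) (span B {x g}) W :=
  have := h.projective_arrow hg
  EV.of_projective

lemma ev_arrow_succ (h : IsGentle k Q e x) {g : Q.E} {n : ℕ}
    (hgc : ∀ c, Q.rel g c → EV B (n + 1) (span B {x c}) W) : EV B (n + 2) (span B {x g}) W := by
  by_cases hg : ∃ c, Q.rel g c
  · obtain ⟨c, hc⟩ := hg
    obtain ⟨i, p, hi, hip, hp, -⟩ := h.exists_syzygy hc
    have := projective_span (h.idem (Q.tgt g))
    exact EV.con₃ hi hip hp (hgc c hc) EV.of_projective
  · exact h.ev_arrow_of_not_rel (fun c hc => hg ⟨c, hc⟩) _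

lemma ev_one_arrow (h : IsGentle k Q e x) {g c : Q.E} (hgc : Q.rel g c)
    (hW : ∀ y : W, e (Q.tgt c) • y = y → (∀ d, Q.rel c d → x d • y = 0) → ∃ z, y = x c • z) :
    EV B 1 (span B {x g}) W := by
  obtain ⟨i, p, hi, hip, hp, hix⟩ := h.exists_syzygy hgc
  have := projective_span (h.idem (Q.tgt g))
  refine EV.one_of_extend hi hip hp EV.of_projective fun φ => ?_
  obtain ⟨z, hz⟩ := hW (φ ⟨x c, mem_span_singleton_self _⟩)
    (by rw [← map_smul]; exact congrArg φ (Subtype.ext (h.tgt c)))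
    (fun d hd => by
      rw [← map_smul, ← map_zero φ]
      exact congrArg φ (Subtype.ext (h.rel c d hd)))
  refine ⟨LinearMap.toSpanSingleton B W z ∘ₗ (span B {e (Q.tgt g)}).subtype,
    LinearMap.ext fun y => ?_⟩
  obtain ⟨r, hr⟩ := mem_span_singleton.1 y.2
  have hy : y = r • ⟨x c, mem_span_singleton_self _⟩ := Subtype.ext hr.symm
  change (i y : B) • z = φ y
  rw [hix, ← hr, hy, map_smul, hz, smul_eq_mul, mul_smul]

/-- Homomorphisms splitting the left ideal generated by the arrows into the ideals generated by
the individual arrows. -/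
lemma exists_radical_proj (h : IsGentle k Q e x) :
    ∃ s : ∀ g, span B (Set.range x) →ₗ[B] span B {x g},
      (∀ (g : Q.E) (r : Q.E → B) (y : span B (Set.range x)), (y : B) = ∑ c, r c * x c →
        (s g y : B) = r g * x g) ∧
      ∀ y : span B (Set.range x), ∃ r : Q.E → B, (y : B) = ∑ c, r c * x c := by
  classical
  let p : (Q.E → B) →ₗ[B] span B (Set.range x) :=
    (Fintype.linearCombination B x).codRestrict _ fun r =>
      sum_mem fun c _ => smul_mem _ _ (subset_span ⟨c, rfl⟩)
  have hp : ∀ r, (p r : B) = ∑ c, r c * x c := fun r => Fintype.linearCombination_apply B x r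
  have hsurj : Function.Surjective p := by
    rintro ⟨y, hy⟩
    rw [← Fintype.range_linearCombination B] at hy
    obtain ⟨r, rfl⟩ := hy
    exact ⟨r, rfl⟩
  have : ∀ g, ∃ ψ : span B (Set.range x) →ₗ[B] span B {x g}, ∀ r, (ψ (p r) : B) = r g * x g := by
    intro g
    let q : (Q.E → B) →ₗ[B] span B {x g} := ((LinearMap.toSpanSingleton B B (x g)).codRestrict
      (span B {x g}) fun r => smul_mem _ r (mem_span_singleton_self _)) ∘ₗ LinearMap.proj g
    obtain ⟨ψ, hψ⟩ := exists_factor_surj (f := (LinearMap.ker p).subtype)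
      (LinearMap.exact_subtype_ker_map p) hsurj q (fun r => Subtype.ext (by
        have h1 := h.mem_span_of_sum_eq_zero r.1 ((hp r.1).symm.trans (congrArg Subtype.val r.2)) g
        have h2 : ∀ y ∈ span B {y | ∃ d, Q.rel g d ∧ y = x d}, y * x g = 0 := by
          intro y hy
          induction hy using Submodule.span_induction with
          | mem y hy => obtain ⟨d, hd, rfl⟩ := hy; exact h.rel g d hd
          | zero => exact zero_mul _
          | add y z _ _ hy hz => rw [add_mul, hy, hz, add_zero]
          | smul a y _ hy => rw [smul_eq_mul, mul_assoc, hy, mul_zero]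
        have h3 := h2 _ h1
        rw [mul_assoc, h.tgt] at h3
        exact h3))
    exact ⟨ψ, fun r => congrArg Subtype.val (hψ r)⟩
  choose s hs using this
  refine ⟨s, fun g r y hy => ?_, fun y => ?_⟩
  · rw [← hs, show y = p r from Subtype.ext (hy.trans (hp r).symm)]
  · obtain ⟨r, rfl⟩ := hsurj y
    exact ⟨r, hp r⟩

lemma ev_radical (h : IsGentle k Q e x) {n : ℕ} (hW : ∀ g, EV B n (span B {x g}) W) :
    EV B n (span B (Set.range x)) W := by
  obtain ⟨s, hs, hr⟩ := h.exists_radical_proj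
  have hle : ∀ g, span B {x g} ≤ span B (Set.range x) := fun g =>
    span_mono (Set.singleton_subset_iff.2 ⟨g, rfl⟩)
  refine EV.of_sum s (fun g => inclusion (hle g)) (LinearMap.ext fun y => Subtype.ext ?_) hW
  obtain ⟨r, hy⟩ := hr y
  rw [LinearMap.sum_apply, coe_sum, LinearMap.id_apply, hy]
  exact Finset.sum_congr rfl fun g _ => hs g r y hy

lemma ev_vSimple (h : IsGentle k Q e x) {n : ℕ} (hW : ∀ g, EV B (n + 1) (span B {x g}) W)
    (v : Q.V) : EV B (n + 2) (VSimple e x v) W := by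
  have h1 : EV B (n + 2) (B ⧸ span B (Set.range x)) W :=
    EV.con₃ (subtype_injective _) (LinearMap.exact_subtype_mkQ _) (mkQ_surjective _)
      (h.ev_radical hW) EV.of_projective
  have hv : e v • VSimple.gen e x v = VSimple.gen e x v := VSimple.e_smul_gen v
  let r : (B ⧸ span B (Set.range x)) →ₗ[B] VSimple e x v := factor (span_mono Set.subset_union_left)
  obtain ⟨s, hs⟩ := exists_vSimple_hom (e := e) (x := x) (v := v)
    (z := (Submodule.Quotient.mk (e v) : B ⧸ span B (Set.range x)))
    (by rw [← Quotient.mk_smul, smul_eq_mul, h.idem])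
    (fun c => by
      rw [← Quotient.mk_smul, smul_eq_mul, Quotient.mk_eq_zero]
      by_cases hc : Q.src c = v
      · rw [← hc, h.src]
        exact subset_span ⟨c, rfl⟩
      · rw [h.mul_e hc]
        exact zero_mem _)
  refine EV.of_retract s r (LinearMap.ext fun y => ?_) h1
  obtain ⟨a, rfl⟩ := h.exists_smul_gen y
  rw [LinearMap.id_apply, LinearMap.map_smul_of_tower, LinearMap.comp_apply, hs]
  congr 1
  refine Eq.trans ?_ hv
  rw [VSimple.gen, ← Quotient.mk_smul, smul_eq_mul, mul_one]
  rfl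

lemma ev_succ_of_arrows (h : IsGentle k Q e x) [Module.Finite k B] {n : ℕ}
    (hW : ∀ g, EV B (n + 1) (span B {x g}) W) (X : Type u) [AddCommGroup X] [Module B X]
    [Module.Finite B X] : EV B (n + 2) X W :=
  h.ev_of_vSimple (h.ev_vSimple hW) X

lemma ev_arrow_of_one (h : IsGentle k Q e x) (hW : ∀ g, EV B 1 (span B {x g}) W) (n : ℕ) (g : Q.E) :
    EV B (n + 1) (span B {x g}) W := by
  induction n generalizing g with
  | zero => exact hW g
  | succ n ih => exact h.ev_arrow_succ fun c _ => ih c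

/-- If every arrow starting a relation acts exactly on `W`, then `W` has injective dimension at
most one. -/
lemma ev_of_one (h : IsGentle k Q e x) [Module.Finite k B] (hW : ∀ g, EV B 1 (span B {x g}) W)
    (n : ℕ) (X : Type u) [AddCommGroup X] [Module B X] [Module.Finite B X] : EV B (n + 2) X W :=
  h.ev_succ_of_arrows (h.ev_arrow_of_one hW n) X

/-- If every relation can be continued, the regular module has injective dimension at most one. -/
lemma ev_self_of_continued (h : IsGentle k Q e x) [Module.Finite k B]
    (hQ : ∀ c d, Q.rel c d → ∃ f, Q.rel d f) (n : ℕ) (X : Type u) [AddCommGroup X] [Module B X]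
    [Module.Finite B X] : EV B (n + 2) X B := by
  refine h.ev_of_one (fun g => ?_) n X
  by_cases hg : ∃ c, Q.rel g c
  · obtain ⟨c, hc⟩ := hg
    refine h.ev_one_arrow hc fun y hy hy' => ?_
    obtain ⟨d, hd⟩ := hQ g c hc
    obtain ⟨c', hc', b, hb⟩ := h.exists_eq_mul_of_mul_eq_zero (hy' d hd) ⟨c, hd⟩
    rw [Q.rel_left_unique d c' c hc' hd] at hb
    refine ⟨b, ?_⟩
    rw [← hy, Q.rel_comp c d hd]
    exact hb
  · exact h.ev_arrow_of_not_rel (fun c hc => hg ⟨c, hc⟩) 0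

end IsGentle

end ArrowModules

/-- A relation `c d` which cannot be continued, in a finite-dimensional gentle algebra of rank
two: the arrows `c` and `d` form an oriented cycle, and there is at most one further arrow, which
is parallel to `d` and forms a relation with `c`. -/
structure IsTerminalPair (Q : GentleQuiverData.{u}) (c d : Q.E) : Prop where
  rel : Q.rel c d
  terminal : ∀ f, ¬ Q.rel d f
  ne : Q.src d ≠ Q.tgt d
  src_eq : Q.src c = Q.tgt d
  vertex : ∀ v, v = Q.src d ∨ v = Q.tgt d
  arrow : ∀ g, g = c ∨ g = d ∨ (Q.rel g c ∧ Q.src g = Q.src d)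

section TerminalPair

variable {k : Type u} [Field k] {Q : GentleQuiverData.{u}} {B : Type u} [Ring B] [Algebra k B]
  {e : Q.V → B} {x : Q.E → B}

lemma IsGentle.isTerminalPair (h : IsGentle k Q e x) [Module.Finite k B]
    (hV : Fintype.card Q.V = 2) {c d : Q.E} (hcd : Q.rel c d) (hd : ∀ f, ¬ Q.rel d f) :
    IsTerminalPair Q c d := by
  have hcomp := Q.rel_comp c d hcd
  have hloop : ∀ a, Q.src a = Q.tgt a → Q.rel a a := fun a ha => by_contra fun hra =>
    h.no_cycle {a} ⟨a, rfl⟩ fun s hs => by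
      rw [Set.mem_singleton_iff.1 hs]
      exact ⟨a, rfl, ha.symm, hra⟩
  have hne : Q.src d ≠ Q.tgt d := fun hh => hd d (hloop d hh)
  have hvert : ∀ v, v = Q.src d ∨ v = Q.tgt d := by
    classical
    intro v
    by_contra hv
    push Not at hv
    have h3 : ({v, Q.src d, Q.tgt d} : Finset Q.V).card = 3 :=
      Finset.card_eq_three.2 ⟨_, _, _, hv.1, hv.2, hne, rfl⟩
    have h4 := Finset.card_le_univ ({v, Q.src d, Q.tgt d} : Finset Q.V)
    omega
  have hcloop : Q.src c ≠ Q.tgt c := fun hh => hd c (by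
    have := Q.rel_right_unique c c d (hloop c hh) hcd
    rw [← this]
    exact hloop c hh)
  have hsrc : Q.src c = Q.tgt d :=
    (hvert _).resolve_left fun hh => hcloop (hh.trans hcomp.symm)
  refine ⟨hcd, hd, hne, hsrc, hvert, fun g => ?_⟩
  by_contra hg
  push Not at hg
  obtain ⟨hgc, hgd, hg⟩ := hg
  rcases hvert (Q.src g) with hs | hs
  · rcases hvert (Q.tgt g) with ht | ht
    · refine h.no_cycle {d, c, g} ⟨d, Or.inl rfl⟩ ?_
      rintro s (rfl | rfl | rfl)
      · exact ⟨g, Or.inr (Or.inr rfl), ht, fun hr =>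
          hgd (Q.rel_right_unique g g s (hloop g (hs.trans ht.symm)) hr)⟩
      · exact ⟨d, Or.inl rfl, hsrc.symm, hd _⟩
      · exact ⟨c, Or.inr (Or.inl rfl), hcomp.trans hs.symm, fun hr =>
          hgd (Q.rel_right_unique c _ d hr hcd)⟩
    · refine h.no_cycle {g, c} ⟨g, Or.inl rfl⟩ ?_
      rintro s (rfl | rfl)
      · exact ⟨c, Or.inr rfl, hcomp.trans hs.symm, fun hr =>
          hgd (Q.rel_right_unique c _ d hr hcd)⟩
      · exact ⟨g, Or.inl rfl, ht.trans hsrc.symm, fun hr => hg hr hs⟩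
  · exact hgc (Q.nonrel_right_unique d g c hs.symm (hd _) hsrc.symm (hd _))

namespace IsTerminalPair

variable {c d : Q.E} {W : Type u} [AddCommGroup W] [Module B W]

lemma comp (t : IsTerminalPair Q c d) : Q.tgt c = Q.src d := Q.rel_comp c d t.rel

lemma ev_d (t : IsTerminalPair Q c d) (h : IsGentle k Q e x) (n : ℕ) :
    EV B (n + 1) (Submodule.span B {x d}) W :=
  h.ev_arrow_of_not_rel t.terminal n

lemma ev_c (t : IsTerminalPair Q c d) (h : IsGentle k Q e x) (n : ℕ) :
    EV B (n + 2) (Submodule.span B {x c}) W :=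
  h.ev_arrow_succ fun g hg => by rw [Q.rel_right_unique c g d hg t.rel]; exact t.ev_d h n

lemma ev_arrow (t : IsTerminalPair Q c d) (h : IsGentle k Q e x) {n : ℕ}
    (hc : EV B (n + 1) (Submodule.span B {x c}) W) (g : Q.E) :
    EV B (n + 2) (Submodule.span B {x g}) W := by
  rcases t.arrow g with rfl | rfl | ⟨hg, -⟩
  · exact t.ev_c h n
  · exact t.ev_d h (n + 1)
  · exact h.ev_arrow_succ fun f hf => by rw [Q.rel_right_unique g f c hf hg]; exact hc

lemma ev_three (t : IsTerminalPair Q c d) (h : IsGentle k Q e x) [Module.Finite k B]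
    (hc : EV B 1 (Submodule.span B {x c}) W) (X : Type u) [AddCommGroup X] [Module B X]
    [Module.Finite B X] : EV B 3 X W :=
  h.ev_succ_of_arrows (t.ev_arrow h hc) X

lemma pdLE (t : IsTerminalPair Q c d) (h : IsGentle k Q e x) [Module.Finite k B]
    (X : Type u) [AddCommGroup X] [Module B X] [Module.Finite B X] : PdLE B 3 X := by
  intro Y _ _ n hn
  obtain ⟨m, rfl⟩ : ∃ m, n = m + 4 := ⟨n - 4, by omega⟩
  exact h.ev_succ_of_arrows (t.ev_arrow h (t.ev_c h m)) X

lemma ev_one_c (t : IsTerminalPair Q c d) (h : IsGentle k Q e x)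
    (hW : ∀ y : W, e (Q.tgt d) • y = y → ∃ z, y = x d • z) :
    EV B 1 (Submodule.span B {x c}) W :=
  h.ev_one_arrow t.rel fun y hy _ => hW y hy

lemma ev_one_of_rel (t : IsTerminalPair Q c d) (h : IsGentle k Q e x) {f : Q.E} (hf : Q.rel f c)
    (hW : ∀ y : W, e (Q.src d) • y = y → x d • y = 0 → ∃ z, y = x c • z) :
    EV B 1 (Submodule.span B {x f}) W :=
  h.ev_one_arrow hf fun y hy hy' => hW y (by rwa [← t.comp]) (hy' d t.rel)

lemma ev_one (t : IsTerminalPair Q c d) (h : IsGentle k Q e x)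
    (hc : EV B 1 (Submodule.span B {x c}) W)
    (hf : ∀ f, Q.rel f c → Q.src f = Q.src d → EV B 1 (Submodule.span B {x f}) W) (g : Q.E) :
    EV B 1 (Submodule.span B {x g}) W := by
  rcases t.arrow g with rfl | rfl | ⟨hg, hg'⟩
  · exact hc
  · exact t.ev_d h 0
  · exact hf g hg hg'

lemma mem_radical (t : IsTerminalPair Q c d) (h : IsGentle k Q e x) {f : Q.E} (hf : Q.rel f c)
    {m : W} (hm : e (Q.src d) • m = m) (hfm : x f • m = 0) (hm0 : m ≠ 0) {y : B}
    (hy : y * e (Q.src d) = y) (hym : y • m = 0) : y ∈ Submodule.span B (Set.range x) := by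
  let _ : Module k W := Module.compHom W (algebraMap k B)
  have : IsScalarTower k B W := isScalarTower_compHom k W
  obtain ⟨a, r, hr⟩ := h.exists_decomp y
  have hea : (∑ v, a v • e v) * e (Q.src d) = a (Q.src d) • e (Q.src d) := by
    rw [Finset.sum_mul, Finset.sum_eq_single (Q.src d)
      (fun w _ hw => by rw [smul_mul_assoc, h.orth _ _ hw, smul_zero])
      (fun hv => absurd (Finset.mem_univ _) hv), smul_mul_assoc, h.idem]
  have hxa : (∑ g, r g * x g) * e (Q.src d) ∈ Submodule.span B (Set.range x) := by
    rw [Finset.sum_mul]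
    refine Submodule.sum_mem _ fun g _ => ?_
    rw [mul_assoc]
    refine Submodule.smul_mem _ (r g) ?_
    by_cases hg : Q.src g = Q.src d
    · rw [← hg, h.src]
      exact Submodule.subset_span ⟨g, rfl⟩
    · rw [h.mul_e hg]
      exact Submodule.zero_mem _
  by_cases ha : a (Q.src d) = 0
  · rw [← hy, hr, add_mul, hea, ha, zero_smul, zero_add]
    exact hxa
  exfalso
  apply hm0
  have hxm : ∀ g, g ≠ d → x g • m = 0 := by
    intro g hg
    rcases t.arrow g with rfl | rfl | ⟨hg', -⟩
    · rw [← hm, ← mul_smul, h.mul_e (fun hh => t.ne (hh.symm.trans t.src_eq)), zero_smul]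
    · exact absurd rfl hg
    · rw [Q.rel_left_unique c g f hg' hf, hfm]
  have h1 : a (Q.src d) • m + r d • x d • m = 0 := by
    have h2 : y • m = (∑ v, a v • e v) • m + (∑ g, r g * x g) • m := by rw [hr, add_smul]
    rw [hym] at h2
    rw [h2]
    congr 1
    · conv_rhs => rw [← hm, ← mul_smul, hea, smul_assoc, hm]
    · rw [Finset.sum_smul, Finset.sum_eq_single d
        (fun g _ hg => by rw [mul_smul, hxm g hg, smul_zero])
        (fun hv => absurd (Finset.mem_univ _) hv), mul_smul]
  have h2 : ∀ b : B, ∃ b' : B, e (Q.src d) • b • x d • m = x c • b' • x d • m := by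
    intro b
    obtain ⟨a', r', hr'⟩ := h.exists_decomp' b
    refine ⟨r' c, ?_⟩
    have h3 : e (Q.src d) * (∑ v, a' v • e v) * x d = 0 := by
      rw [Finset.mul_sum, Finset.sum_mul]
      refine Finset.sum_eq_zero fun v _ => ?_
      rw [mul_smul_comm, smul_mul_assoc]
      by_cases hv : v = Q.src d
      · rw [hv, h.idem, h.e_mul t.ne.symm, smul_zero]
      · rw [h.orth _ _ (Ne.symm hv), zero_mul, smul_zero]
    have h4 : e (Q.src d) * (∑ g, x g * r' g) = x c * r' c := by
      rw [Finset.mul_sum, Finset.sum_eq_single c (fun g _ hg => ?_)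
        (fun hv => absurd (Finset.mem_univ _) hv), ← mul_assoc, ← t.comp, h.tgt]
      have hgt : Q.tgt g ≠ Q.src d := by
        rcases t.arrow g with rfl | rfl | ⟨hg', -⟩
        · exact absurd rfl hg
        · exact t.ne.symm
        · rw [Q.rel_comp g c hg', t.src_eq]
          exact t.ne.symm
      rw [← mul_assoc, h.e_mul hgt, zero_mul]
    rw [← mul_smul, ← mul_smul, hr', mul_add, add_mul, h3, zero_add, h4, mul_smul, mul_smul]
  obtain ⟨b', hb'⟩ := h2 (r d)
  have h3 : a (Q.src d) • m = -(x c • b' • x d • m) := by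
    rw [← hb', ← smul_neg, ← eq_neg_of_add_eq_zero_left h1, smul_comm, hm]
  have h4 : x d • m = 0 := by
    have h5 : a (Q.src d) • x d • m = 0 := by
      rw [smul_comm, h3, smul_neg, ← mul_smul, h.rel c d t.rel, zero_smul, neg_zero]
    exact (smul_eq_zero.1 h5).resolve_left ha
  rw [h4, smul_zero, smul_zero, neg_zero] at h3
  exact (smul_eq_zero.1 h3).resolve_left ha

lemma ev_one_of_not_injective (t : IsTerminalPair Q c d) (h : IsGentle k Q e x)
    [Module.Finite k B] {M : Type u} [AddCommGroup M] [Module B M] [Module.Finite B M]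
    (hM : EV B 2 M M) (hc : EV B 1 (Submodule.span B {x c}) M) {f : Q.E} (hf : Q.rel f c)
    (hfs : Q.src f = Q.src d) {m : M} (hm : e (Q.src d) • m = m) (hfm : x f • m = 0)
    (hm0 : m ≠ 0) : EV B 1 (Submodule.span B {x f}) M := by
  have : IsNoetherianRing B := IsNoetherianRing.of_finite k B
  have hL : EV B 2 (Submodule.span B {m}) M :=
    EV.con₁ (Submodule.subtype_injective _) (LinearMap.exact_subtype_mkQ _)
      (Submodule.mkQ_surjective _) hM (t.ev_three h hc _)
  let p : Submodule.span B {e (Q.src d)} →ₗ[B] Submodule.span B {m} :=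
    ((LinearMap.toSpanSingleton B M m).codRestrict (Submodule.span B {m})
      fun r => Submodule.smul_mem _ r (Submodule.mem_span_singleton_self _)) ∘ₗ
      (Submodule.span B {e (Q.src d)}).subtype
  have hp : Function.Surjective p := fun y => by
    obtain ⟨r, hr⟩ := Submodule.mem_span_singleton.1 y.2
    refine ⟨⟨r * e (Q.src d), Submodule.smul_mem _ r (Submodule.mem_span_singleton_self _)⟩,
      Subtype.ext ?_⟩
    rw [← hr]
    change (r * e (Q.src d)) • m = r • m
    rw [mul_smul, hm]
  have := IsGentle.projective_span (h.idem (Q.src d))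
  have hK : EV B 1 (LinearMap.ker p) M :=
    EV.con₁ (Submodule.subtype_injective _) (LinearMap.exact_subtype_ker_map p) hp
      EV.of_projective hL
  have hle : Submodule.span B {x f} ≤ Submodule.span B {e (Q.src d)} := by
    rw [Submodule.span_le, Set.singleton_subset_iff, SetLike.mem_coe, Submodule.mem_span_singleton]
    exact ⟨x f, by rw [smul_eq_mul, ← hfs, h.src]⟩
  let i : Submodule.span B {x f} →ₗ[B] LinearMap.ker p :=
    (Submodule.inclusion hle).codRestrict _ fun y => Subtype.ext (by
      obtain ⟨r, hr⟩ := Submodule.mem_span_singleton.1 y.2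
      change (y : B) • m = 0
      rw [← hr, smul_eq_mul, mul_smul, hfm, smul_zero])
  let j : LinearMap.ker p →ₗ[B] Submodule.span B (Set.range x) :=
    ((Submodule.span B {e (Q.src d)}).subtype ∘ₗ (LinearMap.ker p).subtype).codRestrict _
      fun y => t.mem_radical h hf hm hfm hm0 (IsGentle.mul_eq_self_of_mem_span (h.idem _) y.1.2)
        (congrArg Subtype.val y.2)
  obtain ⟨s, hs, -⟩ := h.exists_radical_proj
  refine EV.of_retract i (s f ∘ₗ j) (LinearMap.ext fun y => Subtype.ext ?_) hK
  classical
  obtain ⟨r, hr⟩ := Submodule.mem_span_singleton.1 y.2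
  refine (hs f (Pi.single f r) _ ?_).trans ?_
  · rw [Finset.sum_eq_single f (fun g _ hg => by rw [Pi.single_eq_of_ne hg, zero_mul])
      (fun hv => absurd (Finset.mem_univ _) hv), Pi.single_eq_same]
    exact hr.symm
  · rw [Pi.single_eq_same]
    exact hr

lemma injective_of_surjective (t : IsTerminalPair Q c d) (h : IsGentle k Q e x)
    [Module.Finite k B] {M : Type u} [AddCommGroup M] [Module B M] [Module.Finite B M]
    (hM : ∀ y : M, e (Q.tgt d) • y = y → ∃ z, y = x d • z) {f : Q.E} (hf : Q.rel f c)
    (hfM : ∀ m : M, e (Q.src d) • m = m → x f • m = 0 → m = 0) (m : M)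
    (hm : e (Q.src d) • m = m) (hdm : x d • m = 0) : m = 0 := by
  let _ : Module k M := Module.compHom M (algebraMap k B)
  have : IsScalarTower k B M := isScalarTower_compHom k M
  have : Module.Finite k M := Module.Finite.trans B M
  let U : Q.V → Submodule k M := fun v => LinearMap.eqLocus (Algebra.lsmul k k M (e v)) LinearMap.id
  have hft : Q.tgt f = Q.tgt d := (Q.rel_comp f c hf).trans t.src_eq
  let F : U (Q.src d) →ₗ[k] U (Q.tgt d) := (Algebra.lsmul k k M (x f)).restrict fun y _ => by
    change e (Q.tgt d) • x f • y = x f • y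
    rw [← mul_smul, ← hft, h.tgt]
  let D : U (Q.src d) →ₗ[k] U (Q.tgt d) := (Algebra.lsmul k k M (x d)).restrict fun y _ => by
    change e (Q.tgt d) • x d • y = x d • y
    rw [← mul_smul, h.tgt]
  have hF : Function.Injective F := by
    rw [injective_iff_map_eq_zero]
    exact fun y hy => Subtype.ext (hfM y y.2 (congrArg Subtype.val hy))
  have hD : Function.Surjective D := by
    intro y
    obtain ⟨z, hz⟩ := hM y y.2
    refine ⟨⟨e (Q.src d) • z, ?_⟩, Subtype.ext ?_⟩
    · change e (Q.src d) • e (Q.src d) • z = e (Q.src d) • z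
      rw [← mul_smul, h.idem]
    · change x d • e (Q.src d) • z = y
      rw [← mul_smul, h.src, hz]
  have hrank : Module.finrank k (U (Q.src d)) = Module.finrank k (U (Q.tgt d)) :=
    le_antisymm (LinearMap.finrank_le_finrank_of_injective hF) (LinearMap.finrank_le_finrank_of_surjective hD)
  have hDi := (LinearMap.injective_iff_surjective_of_finrank_eq_finrank hrank).2 hD
  exact congrArg Subtype.val ((injective_iff_map_eq_zero D).1 hDi ⟨m, hm⟩ (Subtype.ext hdm))

lemma ev_of_surjective (t : IsTerminalPair Q c d) (h : IsGentle k Q e x)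
    [Module.Finite k B] {M : Type u} [AddCommGroup M] [Module B M] [Module.Finite B M]
    (hM : EV B 2 M M) (hd : ∀ y : M, e (Q.tgt d) • y = y → ∃ z, y = x d • z)
    (n : ℕ) (X : Type u) [AddCommGroup X] [Module B X] [Module.Finite B X] : EV B (n + 2) X M := by
  have hc : EV B 1 (Submodule.span B {x c}) M := t.ev_one_c h hd
  refine h.ev_of_one (t.ev_one h hc fun f hf hfs => ?_) n X
  by_cases hinj : ∀ m : M, e (Q.src d) • m = m → x f • m = 0 → m = 0
  · exact t.ev_one_of_rel h hf fun y hy hdy =>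
      ⟨0, by rw [t.injective_of_surjective h hd hf hinj y hy hdy, smul_zero]⟩
  · push Not at hinj
    obtain ⟨m, hm, hfm, hm0⟩ := hinj
    exact t.ev_one_of_not_injective h hM hc hf hfs hm hfm hm0

end IsTerminalPair

end TerminalPair

section Dual

variable {k : Type u} [Field k] {Q : GentleQuiverData.{u}} {B : Type u} [Ring B] [Algebra k B]
  {e : Q.V → B} {x : Q.E → B}

namespace IsTerminalPair

variable {c d : Q.E}

/-- The two-dimensional module on which only the arrow `d` acts nontrivially. -/
lemma exists_arrow_module (t : IsTerminalPair Q c d) (h : IsGentle k Q e x) :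
    ∃ (W : Type u) (_ : AddCommGroup W) (_ : Module B W) (_ : Module k W)
      (_ : IsScalarTower k B W) (α β : W →ₗ[k] k) (a b : W),
      (∀ w, w = α w • a + β w • b) ∧ α a = 1 ∧ α b = 0 ∧ β b = 1 ∧
      (∀ w, e (Q.src d) • w = α w • a) ∧ (∀ w, e (Q.tgt d) • w = β w • b) ∧
      (∀ w, x d • w = α w • b) ∧ ∀ g, g ≠ d → ∀ w : W, x g • w = 0 := by
  classical
  let i₁ := LinearMap.inl k k k
  let i₂ := LinearMap.inr k k k
  let p₁ := LinearMap.fst k k k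
  let p₂ := LinearMap.snd k k k
  obtain ⟨φ, hφe, hφx⟩ := h.lift (Module.End k (k × k))
    (fun v => if v = Q.src d then i₁ ∘ₗ p₁ else i₂ ∘ₗ p₂)
    (fun g => if g = d then i₂ ∘ₗ p₁ else 0)
    { idem := fun v => by
        split_ifs <;> ext <;> simp [i₁, i₂, p₁, p₂]
      orth := fun v w hvw => by
        rcases t.vertex v with rfl | rfl <;> rcases t.vertex w with rfl | rfl <;>
          simp [t.ne, t.ne.symm] at hvw ⊢ <;> ext <;> simp [i₁, i₂, p₁, p₂]
      sum := by
        have : (Finset.univ : Finset Q.V) = {Q.src d, Q.tgt d} := by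
          ext v
          simpa using t.vertex v
        rw [this, Finset.sum_pair t.ne, if_pos rfl, if_neg t.ne.symm]
        ext <;> simp [i₁, i₂, p₁, p₂]
      src := fun g => by
        by_cases hg : g = d
        · subst hg
          simp only [if_true]
          ext <;> simp [i₁, i₂, p₁]
        · simp [hg]
      tgt := fun g => by
        by_cases hg : g = d
        · subst hg
          simp only [if_true, if_neg t.ne.symm]
          ext <;> simp [i₂, p₁, p₂]
        · simp [hg]
      rel := fun f g hfg => by
        have : f ≠ d := fun hf => t.terminal g (hf ▸ hfg)
        simp [this] }
  let _ : Module B (k × k) := Module.compHom (k × k) φ.toRingHom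
  have hsmul : ∀ (b : B) (w : k × k), b • w = φ b w := fun _ _ => rfl
  have : IsScalarTower k B (k × k) := ⟨fun a b w => by
    rw [hsmul, hsmul, map_smul]
    rfl⟩
  refine ⟨k × k, inferInstance, inferInstance, inferInstance, this, p₁, p₂, (1, 0), (0, 1),
    fun w => by simp [p₁, p₂], rfl, rfl, rfl, fun w => ?_, fun w => ?_, fun w => ?_,
    fun g hg w => ?_⟩
  · rw [hsmul, hφe, if_pos rfl]
    simp [i₁, p₁]
  · rw [hsmul, hφe, if_neg t.ne.symm]
    simp [i₂, p₂]
  · rw [hsmul, hφx, if_pos rfl]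
    simp [i₂, p₁]
  · rw [hsmul, hφx, if_neg hg]
    rfl

lemma exists_arrow_extension (t : IsTerminalPair Q c d) (h : IsGentle k Q e x)
    [Module.Finite k B] :
    ∃ (W : Type u) (_ : AddCommGroup W) (_ : Module B W)
      (f : VSimple e x (Q.tgt d) →ₗ[B] W) (g : W →ₗ[B] VSimple e x (Q.src d)),
      Function.Injective f ∧ Function.Exact f g ∧ Function.Surjective g ∧
      ∀ (n : ℕ) (X : Type u) [AddCommGroup X] [Module B X] [Module.Finite B X],
        EV B (n + 2) X W := by
  obtain ⟨W, _, _, _, _, α, β, a, b, hW, hαa, hαb, hβb, hq, hr, hd, hg⟩ := t.exists_arrow_module h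
  have hαr : ∀ w, α w = 0 → w = β w • b := fun w hw => by
    conv_lhs => rw [hW w, hw, zero_smul, zero_add]
  obtain ⟨f, hf⟩ := IsGentle.exists_vSimple_hom (e := e) (x := x) (v := Q.tgt d) (z := b)
    (by rw [hr, hβb, one_smul]) (fun g => by
      by_cases hgd : g = d
      · rw [hgd, hd, hαb, zero_smul]
      · exact hg g hgd b)
  obtain ⟨g, hgα⟩ := h.exists_hom_vSimple (X := W) (v := Q.src d) α (fun g w => by
      by_cases hgd : g = d
      · rw [hgd, hd, map_smul, hαb, smul_zero]
      · rw [hg g hgd, map_zero])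
    (fun v hv w => by
      rw [(t.vertex v).resolve_left hv, hr, map_smul, hαb, smul_zero])
  refine ⟨W, _, _, f, g, h.injective_of_gen_ne_zero ?_, fun w => ⟨fun hw => ?_, ?_⟩, fun s => ?_,
    fun n X => ?_⟩
  · rw [hf]
    intro hb
    rw [hb, map_zero] at hβb
    exact zero_ne_one hβb
  · rw [hgα] at hw
    refine ⟨β w • VSimple.gen e x _, ?_⟩
    rw [f.map_smul_of_tower, hf]
    exact (hαr w (h.smul_gen_eq_zero hw)).symm
  · rintro ⟨s, rfl⟩
    obtain ⟨r, rfl⟩ := h.exists_smul_gen s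
    rw [hgα, f.map_smul_of_tower, hf, map_smul, hαb, smul_zero, zero_smul]
  · obtain ⟨r, rfl⟩ := h.exists_smul_gen s
    exact ⟨r • a, by rw [hgα, map_smul, hαa, smul_eq_mul, mul_one]⟩
  · intro _ _ _
    refine h.ev_of_one (t.ev_one h (t.ev_one_c h fun y hy => ?_) fun f hf _ =>
      t.ev_one_of_rel h hf fun y hy hdy => ⟨0, ?_⟩) n X
    · refine ⟨β y • a, ?_⟩
      rw [hd, map_smul, hαa, smul_eq_mul, mul_one, ← hr, hy]
    · have h1 : α y = 0 := by
        have := congrArg β (hd y).symm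
        rwa [map_smul, hβb, smul_eq_mul, mul_one, hdy, map_zero] at this
      rw [smul_zero, ← hy, hq, h1, zero_smul]

lemma exists_functional (t : IsTerminalPair Q c d) (h : IsGentle k Q e x)
    {M : Type u} [AddCommGroup M] [Module B M] [Module k M] [IsScalarTower k B M] {m : M}
    (hm : e (Q.tgt d) • m = m) (hmd : ∀ z, m ≠ x d • z) :
    ∃ φ : M →ₗ[k] k, φ m ≠ 0 ∧ (∀ y, φ (e (Q.src d) • y) = 0) ∧ ∀ y, φ (x d • y) = 0 := by
  let p : Submodule k M := LinearMap.range (Algebra.lsmul k k M (e (Q.src d))) ⊔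
    LinearMap.range (Algebra.lsmul k k M (x d))
  have hp : m ∉ p := by
    intro hmp
    obtain ⟨_, ⟨y, rfl⟩, _, ⟨z, rfl⟩, hyz⟩ := Submodule.mem_sup.1 hmp
    change e (Q.src d) • y + x d • z = m at hyz
    apply hmd z
    rw [← hm, ← hyz, smul_add, ← mul_smul, ← mul_smul, h.orth _ _ t.ne.symm, h.tgt, zero_smul,
      zero_add]
  obtain ⟨φ, hφ, hφp⟩ := Submodule.exists_le_ker_of_notMem hp
  exact ⟨φ, hφ, fun y => hφp (Submodule.mem_sup_left ⟨y, rfl⟩),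
    fun y => hφp (Submodule.mem_sup_right ⟨y, rfl⟩)⟩

lemma exists_retract (t : IsTerminalPair Q c d) (h : IsGentle k Q e x) [Module.Finite k B]
    {M : Type u} [AddCommGroup M] [Module B M] [Module k M] [IsScalarTower k B M]
    {φ : M →ₗ[k] k} (hφ : φ ≠ 0) (hφe : ∀ y, φ (e (Q.src d) • y) = 0)
    (hφd : ∀ y, φ (x d • y) = 0) :
    ∃ (s : VSimple e x (Q.src d) →ₗ[B]
        KDual k B ⧸ LinearMap.range (KDual.lift (B := B) φ))
      (r : (KDual k B ⧸ LinearMap.range (KDual.lift (B := B) φ)) →ₗ[B] VSimple e x (Q.src d)),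
      r ∘ₗ s = LinearMap.id := by
  obtain ⟨W, _, _, _, _, α, β, a, b, hW, hαa, hαb, hβb, hq, hr, hd, hg⟩ := t.exists_arrow_module h
  have hxb : ∀ g, x g • b = 0 := fun g => by
    by_cases hgd : g = d
    · rw [hgd, hd, hαb, zero_smul]
    · exact hg g hgd b
  have hda : x d • a = b := by rw [hd, hαa, one_smul]
  have hqa : e (Q.src d) • a = a := by rw [hq, hαa, one_smul]
  have hrb : e (Q.tgt d) • b = b := by rw [hr, hβb, one_smul]
  have hqb : e (Q.src d) • b = 0 := by rw [hq, hαb, zero_smul]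
  have hmem : KDual.lift (B := B) β b ∈ LinearMap.range (KDual.lift (B := B) φ) := by
    have : Nontrivial (LinearMap.range (KDual.lift (B := B) φ)) := by
      obtain ⟨m, hm⟩ := DFunLike.ne_iff.1 hφ
      refine nontrivial_of_ne ⟨KDual.lift φ m, m, rfl⟩ 0 fun h0 => hm ?_
      rw [← one_smul B m, ← KDual.lift_apply]
      exact congrArg (fun f => KDual.toFun k f (1 : B)) (congrArg Subtype.val h0)
    obtain ⟨⟨f, m, rfl⟩, hf0, v, hv, hc⟩ :=
      h.exists_socle (LinearMap.range (KDual.lift (B := B) φ))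
    replace hv := congrArg Subtype.val hv
    replace hc := fun g => congrArg Subtype.val (hc g)
    change e v • KDual.lift φ m = KDual.lift φ m at hv
    change ∀ g, x g • KDual.lift φ m = 0 at hc
    replace hf0 : KDual.lift (B := B) φ m ≠ 0 := fun h0 => hf0 (Subtype.ext h0)
    have hw : ∀ w, w ≠ v → e w • KDual.lift (B := B) φ m = 0 := fun w hw => by
      rw [← hv, ← mul_smul, h.orth w v hw, zero_smul]
    have hval : ∀ (s : Q.V → k) (r : Q.E → B),
        KDual.toFun k (KDual.lift (B := B) φ m) (∑ v, s v • e v + ∑ g, r g * x g) =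
          s v * KDual.toFun k (KDual.lift (B := B) φ m) (e v) := by
      intro s r
      rw [map_add, map_sum, map_sum, Finset.sum_eq_zero (s := Finset.univ) (f := fun g =>
        KDual.toFun k (KDual.lift (B := B) φ m) (r g * x g)) (fun g _ => by
          rw [← KDual.smul_apply, hc g, KDual.zero_apply]), add_zero,
        Finset.sum_eq_single v (fun w _ hwv => by
          rw [map_smul, ← one_mul (e w), ← KDual.smul_apply, hw w hwv, KDual.zero_apply,
            smul_zero]) (fun hv => absurd (Finset.mem_univ _) hv), map_smul, smul_eq_mul]
    have hfv : KDual.toFun k (KDual.lift (B := B) φ m) (e v) ≠ 0 := fun h0 => hf0 (by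
      ext y
      obtain ⟨s, r, rfl⟩ := h.exists_decomp y
      rw [hval, h0, mul_zero, KDual.zero_apply])
    have hvr : v = Q.tgt d := (t.vertex v).resolve_left fun hvq => hfv (by
      rw [KDual.lift_apply, hvq, hφe])
    subst hvr
    have hb : KDual.lift (B := B) β b =
        (KDual.toFun k (KDual.lift (B := B) φ m) (e (Q.tgt d)))⁻¹ • KDual.lift (B := B) φ m := by
      ext y
      obtain ⟨s, r, rfl⟩ := h.exists_decomp y
      change _ = _ * KDual.toFun k (KDual.lift (B := B) φ m) _
      rw [hval, mul_comm, mul_assoc, mul_inv_cancel₀ hfv, mul_one, KDual.lift_apply, add_smul,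
        Finset.sum_smul, Finset.sum_smul, Finset.sum_eq_zero (s := Finset.univ)
        (f := fun g => (r g * x g) • b) (fun g _ => by rw [mul_smul, hxb, smul_zero]), add_zero,
        Finset.sum_eq_single (Q.tgt d) (fun w _ hw => by
          rw [(t.vertex w).resolve_right hw, smul_assoc, hqb, smul_zero])
          (fun hv => absurd (Finset.mem_univ _) hv), smul_assoc, hrb, map_smul, hβb, smul_eq_mul,
        mul_one]
    rw [hb, ← algebraMap_smul B]
    exact Submodule.smul_mem _ _ ⟨m, rfl⟩
  obtain ⟨s, hs⟩ := IsGentle.exists_vSimple_hom (e := e) (x := x) (v := Q.src d)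
    (z := (LinearMap.range (KDual.lift (B := B) φ)).mkQ (KDual.lift β a))
    (by rw [← map_smul, ← map_smul, hqa]) (fun g => by
      rw [← map_smul, ← map_smul]
      by_cases hgd : g = d
      · rw [hgd, hda]
        exact (Submodule.Quotient.mk_eq_zero _).2 hmem
      · rw [hg g hgd, map_zero, map_zero])
  let ev : KDual k B →ₗ[k] k :=
    { toFun := fun f => KDual.toFun k f (x d), map_add' := fun _ _ => rfl, map_smul' := fun _ _ => rfl }
  obtain ⟨r, hr'⟩ := h.exists_hom_vSimple (X := KDual k B) (v := Q.src d) ev (fun g f => by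
      change KDual.toFun k f (x d * x g) = 0
      rcases t.arrow g with rfl | rfl | ⟨hg', -⟩
      · rw [h.rel g d t.rel, map_zero]
      · rw [h.mul_eq_zero_of_ne t.ne.symm, map_zero]
      · rw [h.mul_eq_zero_of_ne fun hh => t.ne (hh.symm.trans ((Q.rel_comp g c hg').trans t.src_eq)),
          map_zero])
    (fun w hw f => by
      change KDual.toFun k f (x d * e w) = 0
      rw [h.mul_e (Ne.symm hw), map_zero])
  refine ⟨s, Submodule.liftQ _ r ?_, LinearMap.ext fun y => ?_⟩
  · rintro _ ⟨m, rfl⟩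
    rw [LinearMap.mem_ker, hr']
    change φ (x d • m) • _ = _
    rw [hφd, zero_smul]
  · obtain ⟨l, rfl⟩ := h.exists_smul_gen y
    rw [LinearMap.map_smul_of_tower, LinearMap.id_apply]
    congr 1
    rw [LinearMap.comp_apply, hs]
    change r (KDual.lift β a) = _
    rw [hr']
    change β (x d • a) • _ = _
    rw [hda, hβb, one_smul]

lemma ev_of_not_surjective (t : IsTerminalPair Q c d) (h : IsGentle k Q e x) [Module.Finite k B]
    {M : Type u} [AddCommGroup M] [Module B M] [Module.Finite B M]
    (hM : ∀ n, EV B (n + 1) M M) {m : M} (hm : e (Q.tgt d) • m = m) (hmd : ∀ z, m ≠ x d • z)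
    (n : ℕ) (X : Type u) [AddCommGroup X] [Module B X] [Module.Finite B X] :
    EV B (n + 2) M X := by
  let _ : Module k M := Module.compHom M (algebraMap k B)
  have : IsScalarTower k B M := isScalarTower_compHom k M
  have : IsNoetherianRing B := IsNoetherianRing.of_finite k B
  obtain ⟨φ, hφm, hφe, hφd⟩ := t.exists_functional h hm hmd
  obtain ⟨s, r, hrs⟩ := t.exists_retract h (φ := φ) (fun h0 => hφm (by rw [h0]; rfl)) hφe hφd
  have hquot : ∀ {n}, EV B (n + 2) M (LinearMap.range (KDual.lift (B := B) φ)) →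
      EV B (n + 1) M (VSimple e x (Q.src d)) := fun hZ =>
    EV.of_retract' s r hrs (EV.cov₃ (Submodule.subtype_injective _)
      (LinearMap.exact_subtype_mkQ _) (Submodule.mkQ_surjective _) EV.of_injective hZ)
  have hrange : ∀ {n}, EV B (n + 2) M (LinearMap.ker (KDual.lift (B := B) φ)) →
      EV B (n + 1) M (LinearMap.range (KDual.lift (B := B) φ)) := fun hK =>
    EV.cov₃ (f := (LinearMap.ker (KDual.lift (B := B) φ)).subtype)
      (g := (KDual.lift (B := B) φ).rangeRestrict) (Submodule.subtype_injective _)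
      (fun y => by
        rw [← LinearMap.exact_subtype_ker_map (KDual.lift (B := B) φ) y]
        exact Subtype.ext_iff)
      (LinearMap.surjective_rangeRestrict _) (hM _) hK
  obtain ⟨W, _, _, f, g, hf, hfg, hg, hW⟩ := t.exists_arrow_extension h
  have h4 : ∀ n (Y : Type u) [AddCommGroup Y] [Module B Y], EV B (n + 4) M Y := fun n Y _ _ =>
    t.pdLE h M Y _ (by omega)
  have hall : ∀ {n}, EV B (n + 1) M (VSimple e x (Q.src d)) →
      EV B (n + 2) M (VSimple e x (Q.src d)) → ∀ (Y : Type u) [AddCommGroup Y] [Module B Y]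
      [Module.Finite B Y], EV B (n + 2) M Y := fun hS hS' Y _ _ _ =>
    h.ev_of_vSimple' (fun v => by
      rcases t.vertex v with rfl | rfl
      · exact hS'
      · exact EV.cov₁ hf hfg hg hS (hW _ M)) Y
  have h2 : EV B 2 M (VSimple e x (Q.src d)) := hquot (hrange (h4 0 _))
  have h3 : EV B 3 M (VSimple e x (Q.src d)) := t.ev_three h (t.ev_one_c h fun y hy => ⟨0, by
    obtain ⟨l, rfl⟩ := h.exists_smul_gen y
    rw [← hy, smul_zero, smul_comm, h.e_smul_gen_of_ne t.ne.symm, smul_zero]⟩) M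
  have h3' := hall h2 h3
  have h1 : EV B 1 M (VSimple e x (Q.src d)) := hquot (hrange (h3' _))
  match n with
  | 0 => exact hall h1 h2 X
  | 1 => exact h3' X
  | n + 2 => exact h4 n X

end IsTerminalPair

lemma IsGentle.exists_isTilting (h : IsGentle k Q e x) [Module.Finite k B]
    (hV : Fintype.card Q.V = 2) {M : Type u} [AddCommGroup M] [Module B M] [Module.Finite B M]
    {p : ℕ} (hp : PdLE B p M) (hM : ∀ n, EV B (n + 1) M M) :
    ∃ N : ModuleCat.{u} B, Module.Finite B N ∧ IsTilting (dSum (ModuleCat.of B M) N) := by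
  by_cases hQ : ∀ c d, Q.rel c d → ∃ f, Q.rel d f
  · exact bongartz k hp hM fun n => h.ev_self_of_continued hQ n M
  · push Not at hQ
    obtain ⟨c, d, hcd, hd⟩ := hQ
    have t := h.isTerminalPair hV hcd hd
    by_cases hs : ∀ y : M, e (Q.tgt d) • y = y → ∃ z, y = x d • z
    · exact dual_bongartz k (fun Y _ _ _ => t.pdLE h Y) hM fun n =>
        t.ev_of_surjective h (hM 1) hs n _
    · push Not at hs
      obtain ⟨m, hm, hmd⟩ := hs
      exact bongartz k hp hM fun n => t.ev_of_not_surjective h hM hm hmd n B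

end Dual

/-- Over a gentle algebra of rank `2`, every (multiplicity-free) pre-tilting
module is partial-tilting. -/
theorem rank_two_pretilting_is_partial_tilting
    (k : Type u) [Field k] [IsAlgClosed k]
    (Q : GentleQuiverData.{u})
    (hfd : FiniteDimensional k (GentleAlg k Q))
    (hrank : Fintype.card Q.V = 2)
    (M : ModuleCat.{u} (GentleAlg k Q)ᵐᵒᵖ)
    (hMfin : Module.Finite (GentleAlg k Q)ᵐᵒᵖ M)
    (hMmf : ∃ m, HasRank M m)
    (hMpre : IsPreTilting M) :
    ∃ N : ModuleCat.{u} (GentleAlg k Q)ᵐᵒᵖ,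
      Module.Finite (GentleAlg k Q)ᵐᵒᵖ N ∧ IsTilting (dSum M N) := by
  have : Module.Finite k (GentleAlg k Q)ᵐᵒᵖ :=
    Module.Finite.equiv (MulOpposite.opLinearEquiv k (M := GentleAlg k Q))
  obtain ⟨d, hd⟩ := hasFiniteProjDim_iff.1 hMpre.1
  exact (gentleAlg_isGentle k Q).exists_isTilting hrank hd fun n => hMpre.2 (n + 1) n.succ_pos
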